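/- arXiv:2311.04041 — 3 statements merged into one kernel-verified Lean document; each statement's English description precedes it below -/
import Mathlib

section
/- Let μ, ν be Borel probability measures on 𝒳 with μ(B_{m₁}) > 0 and ν(B_{m₁}) > 0, (α₁,α̃₁), (α₂,α̃₂) two pairs of tail functions with α₁, α₂ strictly positive, and K : 𝒳×𝒳 → (0,1] measurable. If ∫ g dν > 0 for all g ∈ 𝓖^ν_{α₂,α̃₂} \ {0}, and both inf_{f ∈ 𝓕^{μ,norm}_{α₁,α̃₁}} inf_{g ∈ 𝓖^{ν,norm}_{α₂,α̃₂}} ∫ L_{K^⊤,ν}(g)·f dμ > 0 and sup_{f ∈ 𝓕^{μ,norm}_{α₁,α̃₁}} sup_{g ∈ 𝓖^{ν,norm}_{α₂,α̃₂}} ∫ L_{K^⊤,ν}(g)·f dμ < ∞, then L_{K^⊤,ν} is a strict contraction from (𝓖^ν_{α₂,α̃₂} \ {0}, d_{𝓖^ν_{α₂,α̃₂}}) into (𝓖^μ_{α₁,α̃₁}, d_{𝓖^μ_{α₁,α̃₁}}): there exists κ ∈ (0,1) such that for all g, g̃ ∈ 𝓖^ν_{α₂,α̃₂} \ {0}, one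 has L_{K^⊤,ν}(g), L_{K^⊤,ν}(g̃) ∈ 𝓖^μ_{α₁,α̃₁} and d_{𝓖^μ_{α₁,α̃₁}}(L_{K^⊤,ν}(g), L_{K^⊤,ν}(g̃)) ≤ κ·d_{𝓖^ν_{α₂,α̃₂}}(g, g̃). -/
open MeasureTheory Metric Set Filter
open scoped ENNReal NNReal Topology

noncomputable section

namespace Paper

variable {X : Type*} [MeasurableSpace X] [MetricSpace X] [PolishSpace X] [BorelSpace X]

/-- The cone of test functions `𝓕^μ_{α,α̃}` (as a subset of `L²(μ)`). -/
def Fcone (μ : Measure X) (x₀ : X) (m₁ m₂ : ℝ) (α αt : ℝ → ℝ) :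
    Set (Lp ℝ 2 μ) :=
  {f | (∀ᵐ x ∂μ, x ∈ closedBall x₀ m₂ → 0 ≤ f x)
    ∧ (∀ r, m₁ ≤ r → ∫ x in (closedBall x₀ r)ᶜ, max (f x) 0 ∂μ ≤ α r * ∫ x, f x ∂μ)
    ∧ (∀ r, m₂ ≤ r → ∫ x in (closedBall x₀ r)ᶜ, max (-(f x)) 0 ∂μ ≤ αt r * ∫ x, f x ∂μ)}

/-- The dual cone `𝓖^μ_{α,α̃}`. -/
def Gcone (μ : Measure X) (x₀ : X) (m₁ m₂ : ℝ) (α αt : ℝ → ℝ) :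
    Set (Lp ℝ 2 μ) :=
  {g | ∀ f ∈ Fcone μ x₀ m₁ m₂ α αt, 0 ≤ ∫ x, f x * g x ∂μ}

/-- `M(f,g) = inf { b > 0 : b • g - f ∈ C }`. -/
def Msup {Y : Type*} [AddCommGroup Y] [Module ℝ Y] (C : Set Y) (f g : Y) : ℝ :=
  sInf {b : ℝ | 0 < b ∧ b • g - f ∈ C}

/-- `m(f,g) = sup { a > 0 : f - a • g ∈ C }`. -/
def minf {Y : Type*} [AddCommGroup Y] [Module ℝ Y] (C : Set Y) (f g : Y) : ℝ :=
  sSup {a : ℝ | 0 < a ∧ f - a • g ∈ C}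

/-- `f ∼_C g` : `a • g ≤_C f ≤_C b • g` for some `a, b > 0`. -/
def simC {Y : Type*} [AddCommGroup Y] [Module ℝ Y] (C : Set Y) (f g : Y) : Prop :=
  (∃ a : ℝ, 0 < a ∧ f - a • g ∈ C) ∧ (∃ b : ℝ, 0 < b ∧ b • g - f ∈ C)

open Classical in
/-- Hilbert's projective metric of the cone `C`, with value `∞` when `f ≁_C g` or `g = 0`. -/
def hilbertD {Y : Type*} [AddCommGroup Y] [Module ℝ Y] (C : Set Y) (f g : Y) : ℝ≥0∞ :=
  if simC C f g ∧ g ≠ 0 then ENNReal.ofReal (Real.log (Msup C f g / minf C f g)) else ⊤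

open Classical in
/-- `exp(x) - 1` on `[0,∞]`. -/
def expm1 (x : ℝ≥0∞) : ℝ≥0∞ :=
  if x = ⊤ then ⊤ else ENNReal.ofReal (Real.exp x.toReal - 1)

open Classical in
/-- extended-real logarithm on `[0,∞]`. -/
def elog (x : ℝ≥0∞) : EReal :=
  if x = 0 then ⊥ else if x = ⊤ then ⊤ else ((Real.log x.toReal : ℝ) : EReal)

/-- tail function: non-increasing on `(0,∞)`, non-negative, tending to `0`. -/
def IsTail (α : ℝ → ℝ) : Prop :=
  (∀ r s : ℝ, 0 < r → r ≤ s → α s ≤ α r) ∧ (∀ r : ℝ, 0 < r → 0 ≤ α r) ∧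
    Tendsto α atTop (𝓝 0)

/-- the kernel integral operator `L_{K,ρ}`. -/
def Lker (K : X → X → ℝ) (ρ : Measure X) (f : X → ℝ) : X → ℝ :=
  fun x => ∫ y, K x y * f y ∂ρ

/-- `l` is a lower decay of the kernel `K`. -/
def IsLowerDecay (K : X → X → ℝ) (x₀ : X) (l : ℝ → ℝ) : Prop :=
  (∀ r s : ℝ, r ≤ s → l s ≤ l r) ∧
    ∀ r : ℝ, 0 < r → ∀ x ∈ closedBall x₀ r, ∀ y ∈ closedBall x₀ r, l r ≤ K x y

/-- `β̃(r)`, as an extended real. -/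
def betaTilde (μ : Measure X) (x₀ : X) (m₁ : ℝ) (α : ℝ → ℝ) (r : ℝ) : ℝ≥0∞ :=
  (μ (closedBall x₀ m₁))⁻¹ *
    ⨆ a ∈ Set.Ici r, μ ((closedBall x₀ a)ᶜ) / ENNReal.ofReal (min (α a) 1)

/-- `β(r)`, as an extended real. -/
def betaFun (μ : Measure X) (x₀ : X) (m₁ : ℝ) (αt : ℝ → ℝ) (r : ℝ) : ℝ≥0∞ :=
  (μ (closedBall x₀ m₁))⁻¹ *
    ((⨆ a ∈ Set.Ici r, μ ((closedBall x₀ a)ᶜ) / ENNReal.ofReal (αt a)) + μ ((closedBall x₀ r)ᶜ))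


theorem numeric_aux {m M w η M' m' : ℝ} (hm : 0 < m) (hmw : m ≤ w) (hwM : w ≤ M)
    (hη : 0 < η) (hη1 : η ≤ 1 / 2) (hM'0 : 0 ≤ M')
    (hA1 : M' ≤ M - η * (M - w)) (hA2 : M' ≤ w / η)
    (hB1 : m + η * (w - m) ≤ m') (hB2 : η * w ≤ m') :
    Real.log (M' / m') ≤ max (1 / 2) (1 - η ^ 5) * Real.log (M / m) := by
  have hw : 0 < w := by linarith
  have hM : 0 < M := by linarith
  have hm'0 : 0 < m' := lt_of_lt_of_le (by positivity) hB2
  have hR1 : 1 ≤ M / m := by rw [le_div_iff₀ hm]; linarith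
  have hlog : 0 ≤ Real.log (M / m) := Real.log_nonneg hR1
  have hk : (0:ℝ) ≤ max (1 / 2) (1 - η ^ 5) := le_trans (by norm_num) (le_max_left _ _)
  rcases hM'0.eq_or_lt with h0 | h0
  · rw [← h0]; simp only [zero_div, Real.log_zero]; positivity
  have hQ : 0 < M' / m' := by positivity
  have hQ1 : M' / m' ≤ (1 - η) * (M / m) + η := by
    have : (1 - η) * (M / m) + η = ((1 - η) * M + η * m) / m := by field_simp
    rw [this, div_le_div_iff₀ hm'0 hm]
    have h1 : M' * m ≤ (M - η * (M - w)) * m := by gcongr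
    have hp : 0 ≤ (1 - η) * M + η * m :=
      add_nonneg (mul_nonneg (by linarith) hM.le) (by positivity)
    have h2 : ((1 - η) * M + η * m) * (m + η * (w - m)) ≤ ((1 - η) * M + η * m) * m' := by
      gcongr
    have h3 : 0 ≤ (1 - η) * (M - m) * (η * (w - m)) :=
      mul_nonneg (mul_nonneg (by linarith) (by linarith)) (mul_nonneg hη.le (by linarith))
    nlinarith
  have hQ2 : M' / m' ≤ (η ^ 2)⁻¹ := by
    rw [div_le_iff₀ hm'0]
    calc M' ≤ w / η := hA2
      _ = (η ^ 2)⁻¹ * (η * w) := by field_simp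
      _ ≤ _ := by gcongr
  set R := M / m with hR
  by_cases hc : (η ^ 4)⁻¹ ≤ R
  · calc Real.log (M' / m') ≤ Real.log ((η ^ 2)⁻¹) := Real.log_le_log hQ hQ2
      _ = 1 / 2 * Real.log ((η ^ 4)⁻¹) := by
        rw [Real.log_inv, Real.log_inv, Real.log_pow, Real.log_pow]; push_cast; ring
      _ ≤ 1 / 2 * Real.log R := by
        gcongr
      _ ≤ _ := by gcongr; exact le_max_left _ _
  · push Not at hc
    have hRpos : 0 < R := by linarith
    have hy : 0 < 1 - η * (R - 1) / R := by
      rw [sub_pos, div_lt_one hRpos]; nlinarith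
    calc Real.log (M' / m') ≤ Real.log ((1 - η) * R + η) := Real.log_le_log hQ hQ1
      _ = Real.log (R * (1 - η * (R - 1) / R)) := by congr 1; field_simp; ring
      _ = Real.log R + Real.log (1 - η * (R - 1) / R) := Real.log_mul hRpos.ne' hy.ne'
      _ ≤ Real.log R + (1 - η * (R - 1) / R - 1) := by
        gcongr; exact Real.log_le_sub_one_of_pos hy
      _ ≤ (1 - η ^ 5) * Real.log R := by
        have h1 : Real.log R ≤ R - 1 := Real.log_le_sub_one_of_pos hRpos
        have h2 : η ^ 4 ≤ R⁻¹ := by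
          rw [le_inv_comm₀ (by positivity) hRpos]; exact hc.le
        have h3 : η ^ 4 * Real.log R ≤ R⁻¹ * (R - 1) := by
          apply mul_le_mul h2 h1 hlog (by positivity)
        have h4 := mul_le_mul_of_nonneg_left h3 hη.le
        have h5 : η * (R - 1) / R = η * (R⁻¹ * (R - 1)) := by field_simp
        rw [h5]; nlinarith
      _ ≤ _ := by gcongr; exact le_max_right _ _

theorem birkhoff_aux {Y Z ι κ' : Type*} [AddCommGroup Y] [Module ℝ Y] [AddCommGroup Z] [Module ℝ Z]
    (C : Set Y) (D : Set Z) (ψ : κ' → Y →ₗ[ℝ] ℝ) (φ : ι → Z →ₗ[ℝ] ℝ)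
    (hC : ∀ y, y ∈ C ↔ ∀ j, 0 ≤ ψ j y) (hD : ∀ z, z ∈ D ↔ ∀ i, 0 ≤ φ i z)
    (i₀ : ι) (I : Y →ₗ[ℝ] ℝ) (hI : ∀ y ∈ C, y ≠ 0 → 0 < I y) (T : Y →ₗ[ℝ] Z)
    (η Mb : ℝ) (hη : 0 < η) (hη1 : η ≤ 1 / 2) (hMb : 0 < Mb)
    (hlo : ∀ i, ∀ y ∈ C, η * Mb * I y ≤ φ i (T y))
    (hhi : ∀ i, ∀ y ∈ C, φ i (T y) ≤ Mb * I y)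
    (g : Y) (hg : g ∈ C) (hg0 : g ≠ 0) (g' : Y) (hg' : g' ∈ C) (hg'0 : g' ≠ 0) :
    T g ∈ D ∧ T g' ∈ D ∧
    hilbertD D (T g) (T g') ≤ ENNReal.ofReal (max (1 / 2) (1 - η ^ 5)) * hilbertD C g g' := by
  have hInn : ∀ y ∈ C, 0 ≤ I y := by
    intro y hy
    by_cases h : y = 0
    · simp [h]
    · exact (hI y hy h).le
  have hTD : ∀ y ∈ C, T y ∈ D := by
    intro y hy
    rw [hD]
    intro i
    have := hInn y hy
    exact le_trans (by positivity) (hlo i y hy)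
  refine ⟨hTD g hg, hTD g' hg', ?_⟩
  have hG := hI g hg hg0
  have hG' := hI g' hg' hg'0
  by_cases hs : simC C g g'
  swap
  · have hk : ENNReal.ofReal (max (1 / 2) (1 - η ^ 5)) ≠ 0 := by
      rw [← pos_iff_ne_zero, ENNReal.ofReal_pos]
      exact lt_of_lt_of_le (by norm_num) (le_max_left _ _)
    have : hilbertD C g g' = ⊤ := by simp [hilbertD, hs]
    rw [this, ENNReal.mul_top hk]; exact le_top
  have hB : ∀ i, 0 < φ i (T g') := fun i => lt_of_lt_of_le (by positivity) (hlo i g' hg')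
  have hTg'0 : T g' ≠ 0 := by
    intro h
    have := hB i₀
    simp [h] at this
  have hs' : simC D (T g) (T g') := by
    obtain ⟨⟨a, ha, haC⟩, b, hb, hbC⟩ := hs
    refine ⟨⟨a, ha, ?_⟩, b, hb, ?_⟩
    · simpa using hTD _ haC
    · simpa using hTD _ hbC
  have e1 : hilbertD C g g' = ENNReal.ofReal (Real.log (Msup C g g' / minf C g g')) := by
    simp [hilbertD, hs, hg'0]
  have e2 : hilbertD D (T g) (T g') =
      ENNReal.ofReal (Real.log (Msup D (T g) (T g') / minf D (T g) (T g'))) := by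
    simp [hilbertD, hs', hTg'0]
  rw [e1, e2, ← ENNReal.ofReal_mul (le_trans (by norm_num) (le_max_left _ _))]
  apply ENNReal.ofReal_le_ofReal
  obtain ⟨⟨a, ha, haC⟩, b, hb, hbC⟩ := hs
  have hab : ∀ a b : ℝ, g - a • g' ∈ C → b • g' - g ∈ C → a ≤ b := by
    intro a b h1 h2
    have h1 := hInn _ h1
    have h2 := hInn _ h2
    simp only [map_sub, map_smul, smul_eq_mul] at h1 h2
    have : 0 ≤ (b - a) * I g' := by linarith
    have := nonneg_of_mul_nonneg_left this hG'
    linarith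
  have hma : a ≤ minf C g g' := le_csSup ⟨b, fun x hx => hab x b hx.2 hbC⟩ ⟨ha, haC⟩
  have hmpos : 0 < minf C g g' := by linarith
  have hMC : Msup C g g' • g' - g ∈ C := by
    rw [hC]
    intro j
    have hj := (hC g').1 hg' j
    simp only [map_sub, map_smul, smul_eq_mul, sub_nonneg]
    rcases hj.eq_or_lt with h | h
    · have := (hC _).1 hbC j
      simp only [map_sub, map_smul, smul_eq_mul, sub_nonneg] at this
      rw [← h] at this ⊢; linarith
    · rw [← div_le_iff₀ h]
      refine le_csInf ⟨b, hb, hbC⟩ ?_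
      rintro x ⟨_, hx⟩
      have := (hC _).1 hx j
      simp only [map_sub, map_smul, smul_eq_mul, sub_nonneg] at this
      rwa [div_le_iff₀ h]
  have hmC : g - minf C g g' • g' ∈ C := by
    rw [hC]
    intro j
    have hj := (hC g').1 hg' j
    simp only [map_sub, map_smul, smul_eq_mul, sub_nonneg]
    rcases hj.eq_or_lt with h | h
    · have := (hC _).1 hg j
      rw [← h]; linarith
    · rw [← le_div_iff₀ h]
      refine csSup_le ⟨a, ha, haC⟩ ?_
      rintro x ⟨_, hx⟩
      have := (hC _).1 hx j
      simp only [map_sub, map_smul, smul_eq_mul, sub_nonneg] at this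
      rwa [le_div_iff₀ h]
  set M := Msup C g g'
  set m := minf C g g'
  have hIM := hInn _ hMC
  have hIm := hInn _ hmC
  simp only [map_sub, map_smul, smul_eq_mul, sub_nonneg] at hIM hIm
  set w := I g / I g' with hw
  have hwG : I g = w * I g' := by rw [hw]; field_simp
  have hwpos : 0 < w := by positivity
  have hwM : w ≤ M := by rw [hw, div_le_iff₀ hG']; exact hIM
  have hmw : m ≤ w := by rw [hw, le_div_iff₀ hG']; exact hIm
  have upD : ∀ t : ℝ, 0 < t → (∀ i, φ i (T g) ≤ t * φ i (T g')) → Msup D (T g) (T g') ≤ t := by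
    intro t ht h
    refine csInf_le ⟨0, fun x hx => hx.1.le⟩ ⟨ht, ?_⟩
    rw [hD]; intro i
    simpa using h i
  have loD : ∀ t : ℝ, 0 < t → (∀ i, t * φ i (T g') ≤ φ i (T g)) → t ≤ minf D (T g) (T g') := by
    intro t ht h
    refine le_csSup ⟨φ i₀ (T g) / φ i₀ (T g'), ?_⟩ ⟨ht, ?_⟩
    · rintro x ⟨_, hx⟩
      have := (hD _).1 hx i₀
      simp only [map_sub, map_smul, smul_eq_mul, sub_nonneg] at this
      rwa [le_div_iff₀ (hB i₀)]
    · rw [hD]; intro i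
      simpa using h i
  have hη2 : η < 1 := by linarith
  refine numeric_aux hmpos hmw hwM hη hη1 ?_ ?_ ?_ ?_ ?_
  · exact Real.sInf_nonneg (fun x hx => hx.1.le)
  · apply upD
    · nlinarith
    · intro i
      have h1 := hlo i _ hMC
      have h2 := hhi i _ hg'
      simp only [map_sub, map_smul, smul_eq_mul] at h1
      rw [hwG] at h1
      have h3 := mul_le_mul_of_nonneg_left h2 (mul_nonneg hη.le (sub_nonneg.2 hwM))
      linarith
  · apply upD _ (by positivity)
    intro i
    have h1 := hhi i _ hg
    have h2 := hlo i _ hg'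
    calc _ ≤ _ := h1
      _ = w / η * (η * Mb * I g') := by rw [hwG]; field_simp
      _ ≤ _ := by gcongr
  · apply loD
    · nlinarith
    · intro i
      have h1 := hlo i _ hmC
      have h2 := hhi i _ hg'
      simp only [map_sub, map_smul, smul_eq_mul] at h1
      rw [hwG] at h1
      have h3 := mul_le_mul_of_nonneg_left h2 (mul_nonneg hη.le (sub_nonneg.2 hmw))
      linarith
  · apply loD _ (by positivity)
    intro i
    have h1 := hlo i _ hg
    have h2 := hhi i _ hg'
    calc η * w * φ i (T g') ≤ η * w * (Mb * I g') := by gcongr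
      _ = η * Mb * I g := by rw [hwG]; ring
      _ ≤ _ := h1

theorem lp_integrable (ρ : Measure X) [IsProbabilityMeasure ρ] (f : Lp ℝ 2 ρ) : Integrable f ρ :=
  (Lp.memLp f).integrable (by norm_num)

/-- Integration as a linear functional. -/
def intLin (ρ : Measure X) [IsProbabilityMeasure ρ] : Lp ℝ 2 ρ →ₗ[ℝ] ℝ where
  toFun f := ∫ x, f x ∂ρ
  map_add' f g := by
    rw [integral_congr_ae (Lp.coeFn_add f g)]
    exact integral_add (lp_integrable ρ f) (lp_integrable ρ g)
  map_smul' c f := by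
    rw [integral_congr_ae (Lp.coeFn_smul c f)]
    simp [integral_const_mul]

theorem inner_eq_int (ρ : Measure X) (f g : Lp ℝ 2 ρ) :
    inner ℝ f g = ∫ x, f x * g x ∂ρ := by
  rw [L2.inner_def]
  apply integral_congr_ae
  filter_upwards with x
  simp [mul_comm]

theorem kg_integrable (ν : Measure X) [IsProbabilityMeasure ν]
    (K : X → X → ℝ) (hKmeas : Measurable (Function.uncurry K))
    (hKpos : ∀ x y, 0 < K x y) (hKle : ∀ x y, K x y ≤ 1) (g : Lp ℝ 2 ν) (x : X) :
    Integrable (fun y => K y x * g y) ν := by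
  refine (lp_integrable ν g).bdd_mul (c := 1) ?_ ?_
  · exact (hKmeas.comp (measurable_id.prodMk measurable_const)).aestronglyMeasurable
  · filter_upwards with y
    rw [Real.norm_eq_abs, abs_of_pos (hKpos _ _)]; exact hKle _ _

theorem lker_memLp (μ ν : Measure X) [IsProbabilityMeasure μ] [IsProbabilityMeasure ν]
    (K : X → X → ℝ) (hKmeas : Measurable (Function.uncurry K))
    (hKpos : ∀ x y, 0 < K x y) (hKle : ∀ x y, K x y ≤ 1) (g : Lp ℝ 2 ν) :
    MemLp (Lker (fun a b => K b a) ν ⇑g) 2 μ := by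
  refine MemLp.of_bound (C := ∫ y, |g y| ∂ν) ?_ ?_
  · apply StronglyMeasurable.aestronglyMeasurable
    have h : StronglyMeasurable (Function.uncurry (fun x y => K y x * g y)) := by
      apply Measurable.stronglyMeasurable
      exact (hKmeas.comp measurable_swap).mul
        ((Lp.stronglyMeasurable g).measurable.comp measurable_snd)
    exact h.integral_prod_right
  · filter_upwards with x
    refine (norm_integral_le_integral_norm _).trans ?_
    apply integral_mono (kg_integrable ν K hKmeas hKpos hKle g x).norm
      (lp_integrable ν g).abs
    intro y
    simp only [norm_mul, Real.norm_eq_abs, abs_of_pos (hKpos _ _)]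
    exact mul_le_of_le_one_left (abs_nonneg _) (hKle _ _)

/-- The kernel operator as a linear map on `L²`. -/
def kerLin (μ ν : Measure X) [IsProbabilityMeasure μ] [IsProbabilityMeasure ν]
    (K : X → X → ℝ) (hKmeas : Measurable (Function.uncurry K))
    (hKpos : ∀ x y, 0 < K x y) (hKle : ∀ x y, K x y ≤ 1) : Lp ℝ 2 ν →ₗ[ℝ] Lp ℝ 2 μ where
  toFun g := (lker_memLp μ ν K hKmeas hKpos hKle g).toLp _
  map_add' f g := by
    rw [← MemLp.toLp_add]
    congr 1
    funext x
    simp only [Lker, Pi.add_apply]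
    rw [← integral_add (kg_integrable ν K hKmeas hKpos hKle f x)
      (kg_integrable ν K hKmeas hKpos hKle g x)]
    apply integral_congr_ae
    filter_upwards [Lp.coeFn_add f g] with y hy
    rw [hy, Pi.add_apply, mul_add]
  map_smul' c f := by
    rw [RingHom.id_apply, ← MemLp.toLp_const_smul]
    congr 1
    funext x
    simp only [Lker, Pi.smul_apply, smul_eq_mul]
    rw [← integral_const_mul]
    apply integral_congr_ae
    filter_upwards [Lp.coeFn_smul c f] with y hy
    rw [hy, Pi.smul_apply, smul_eq_mul]; ring

theorem fcone_smul (ρ : Measure X) [IsProbabilityMeasure ρ] (x₀ : X) (m₁ m₂ : ℝ) (α αt : ℝ → ℝ)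
    (f : Lp ℝ 2 ρ) (hf : f ∈ Fcone ρ x₀ m₁ m₂ α αt) (c : ℝ) (hc : 0 ≤ c) :
    c • f ∈ Fcone ρ x₀ m₁ m₂ α αt := by
  obtain ⟨h1, h2, h3⟩ := hf
  have hI : ∫ x, (c • f) x ∂ρ = c * ∫ x, f x ∂ρ := (intLin ρ).map_smul c f
  refine ⟨?_, ?_, ?_⟩
  · filter_upwards [h1, Lp.coeFn_smul c f] with x hx hy hb
    rw [hy]
    exact mul_nonneg hc (hx hb)
  · intro r hr
    have : ∫ x in (closedBall x₀ r)ᶜ, max ((c • f) x) 0 ∂ρ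
        = c * ∫ x in (closedBall x₀ r)ᶜ, max (f x) 0 ∂ρ := by
      rw [← integral_const_mul]
      apply integral_congr_ae
      filter_upwards [ae_restrict_of_ae (Lp.coeFn_smul c f)] with x hx
      rw [hx, mul_max_of_nonneg _ _ hc]; simp
    rw [this, hI]
    have := mul_le_mul_of_nonneg_left (h2 r hr) hc
    linarith
  · intro r hr
    have : ∫ x in (closedBall x₀ r)ᶜ, max (-((c • f) x)) 0 ∂ρ
        = c * ∫ x in (closedBall x₀ r)ᶜ, max (-(f x)) 0 ∂ρ := by
      rw [← integral_const_mul]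
      apply integral_congr_ae
      filter_upwards [ae_restrict_of_ae (Lp.coeFn_smul c f)] with x hx
      rw [hx, mul_max_of_nonneg _ _ hc]; simp
    rw [this, hI]
    have := mul_le_mul_of_nonneg_left (h3 r hr) hc
    linarith

theorem fcone_pos (ρ : Measure X) [IsProbabilityMeasure ρ] (x₀ : X) (m₁ m₂ : ℝ) (hm₁ : 0 < m₁)
    (α αt : ℝ → ℝ) (hα : ∀ r : ℝ, 0 < r → 0 < α r)
    (f : Lp ℝ 2 ρ) (hf : f ∈ Fcone ρ x₀ m₁ m₂ α αt) :
    f = 0 ∨ 0 < intLin ρ f := by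
  obtain ⟨h1, h2, h3⟩ := hf
  have h0 : 0 ≤ α m₁ * ∫ x, f x ∂ρ :=
    le_trans (integral_nonneg (fun x => le_max_right _ _)) (h2 m₁ le_rfl)
  have h0' : 0 ≤ ∫ x, f x ∂ρ := nonneg_of_mul_nonneg_right h0 (hα m₁ hm₁)
  rcases h0'.eq_or_lt with h | h
  swap
  · exact Or.inr h
  left
  have h4 := h3 m₂ le_rfl
  rw [← h, mul_zero] at h4
  have hint : Integrable (fun x => max (-(f x)) 0) ρ :=
    (lp_integrable ρ f).neg.pos_part
  have h5 : ∫ x in (closedBall x₀ m₂)ᶜ, max (-(f x)) 0 ∂ρ = 0 :=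
    le_antisymm h4 (integral_nonneg (fun x => le_max_right _ _))
  replace h5 := (integral_eq_zero_iff_of_nonneg (f := fun x => max (-(f x)) 0)
    (fun x => le_max_right (-(f x)) 0) hint.restrict).1 h5
  have h6 := (ae_restrict_iff' (measurableSet_closedBall (x := x₀) (ε := m₂)).compl).1 h5
  have h7 : 0 ≤ᵐ[ρ] f := by
    filter_upwards [h1, h6] with x hx hy
    by_cases hb : x ∈ closedBall x₀ m₂
    · exact hx hb
    · have := hy hb
      have h8 : -(f x) ≤ max (-(f x)) 0 := le_max_left _ _
      simp only [Pi.zero_apply] at this ⊢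
      linarith
  have h8 := (integral_eq_zero_iff_of_nonneg_ae h7 (lp_integrable ρ f)).1 h.symm
  exact (Lp.eq_zero_iff_ae_eq_zero).2 h8

theorem fcone_exists (ρ : Measure X) [IsProbabilityMeasure ρ] (x₀ : X) (m₁ m₂ : ℝ) (hm₁ : 0 < m₁)
    (hm₁₂ : m₁ ≤ m₂)
    (α αt : ℝ → ℝ) (hα : IsTail α) (hαt : IsTail αt) (hρ : 0 < ρ (closedBall x₀ m₁)) :
    ∃ f ∈ Fcone ρ x₀ m₁ m₂ α αt, intLin ρ f = 1 := by
  have hB : MeasurableSet (closedBall x₀ m₁) := measurableSet_closedBall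
  let f : Lp ℝ 2 ρ := indicatorConstLp 2 hB (measure_ne_top ρ _) (1:ℝ)
  have hf : f =ᵐ[ρ] (closedBall x₀ m₁).indicator (fun _ => (1:ℝ)) := indicatorConstLp_coeFn
  have hI : ∫ x, f x ∂ρ = ρ.real (closedBall x₀ m₁) := by
    rw [integral_congr_ae hf, integral_indicator hB]; simp
  have hIp : 0 < ρ.real (closedBall x₀ m₁) :=
    ENNReal.toReal_pos hρ.ne' (measure_ne_top ρ _)
  have hfF : f ∈ Fcone ρ x₀ m₁ m₂ α αt := by
    refine ⟨?_, ?_, ?_⟩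
    · filter_upwards [hf] with x hx _
      rw [hx]; exact indicator_nonneg (fun _ _ => zero_le_one) x
    · intro r hr
      have : ∫ x in (closedBall x₀ r)ᶜ, max (f x) 0 ∂ρ = 0 := by
        rw [setIntegral_eq_zero_of_ae_eq_zero]
        filter_upwards [hf] with x hx hxr
        have : x ∉ closedBall x₀ m₁ := fun h => hxr (closedBall_subset_closedBall hr h)
        rw [hx, indicator_of_notMem this]; simp
      rw [this, hI]
      exact mul_nonneg (hα.2.1 r (by linarith)) hIp.le
    · intro r hr
      have : ∫ x in (closedBall x₀ r)ᶜ, max (-(f x)) 0 ∂ρ = 0 := by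
        rw [setIntegral_eq_zero_of_ae_eq_zero]
        filter_upwards [hf] with x hx hxr
        rw [hx]
        exact max_eq_right (by simpa using indicator_nonneg (fun _ _ => zero_le_one) x)
      rw [this, hI]
      exact mul_nonneg (hαt.2.1 r (by linarith)) hIp.le
  refine ⟨(ρ.real (closedBall x₀ m₁))⁻¹ • f,
    fcone_smul ρ x₀ m₁ m₂ α αt f hfF _ (by positivity), ?_⟩
  have : intLin ρ f = ρ.real (closedBall x₀ m₁) := hI
  rw [map_smul, this, smul_eq_mul, inv_mul_cancel₀ hIp.ne']

theorem statement8 (μ ν : Measure X) [IsProbabilityMeasure μ] [IsProbabilityMeasure ν]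
    (x₀ : X) (m₁ m₂ : ℝ) (hm₁ : 0 < m₁) (hm₁₂ : m₁ ≤ m₂)
    (α₁ αt₁ α₂ αt₂ : ℝ → ℝ)
    (h1 : IsTail α₁) (h2 : IsTail αt₁) (h3 : IsTail α₂) (h4 : IsTail αt₂)
    (hα₁pos : ∀ r : ℝ, 0 < r → 0 < α₁ r) (hα₂pos : ∀ r : ℝ, 0 < r → 0 < α₂ r)
    (hμm : 0 < μ (closedBall x₀ m₁)) (hνm : 0 < ν (closedBall x₀ m₁))
    (K : X → X → ℝ) (hKmeas : Measurable (Function.uncurry K))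
    (hKpos : ∀ x y, 0 < K x y) (hKle : ∀ x y, K x y ≤ 1)
    (hpos : ∀ g ∈ Gcone ν x₀ m₁ m₂ α₂ αt₂, g ≠ 0 → 0 < ∫ x, g x ∂ν)
    (hinf : ∃ e : ℝ, 0 < e ∧ ∀ f ∈ Fcone μ x₀ m₁ m₂ α₁ αt₁, (∫ x, f x ∂μ) = 1 →
      ∀ g ∈ Gcone ν x₀ m₁ m₂ α₂ αt₂, (∫ x, g x ∂ν) = 1 →
        e ≤ ∫ x, Lker (fun a b => K b a) ν (⇑g) x * f x ∂μ)
    (hsup : ∃ Mb : ℝ, ∀ f ∈ Fcone μ x₀ m₁ m₂ α₁ αt₁, (∫ x, f x ∂μ) = 1 →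
      ∀ g ∈ Gcone ν x₀ m₁ m₂ α₂ αt₂, (∫ x, g x ∂ν) = 1 →
        ∫ x, Lker (fun a b => K b a) ν (⇑g) x * f x ∂μ ≤ Mb) :
    ∃ κ : ℝ, 0 < κ ∧ κ < 1 ∧
      ∀ g ∈ Gcone ν x₀ m₁ m₂ α₂ αt₂, g ≠ 0 →
      ∀ g' ∈ Gcone ν x₀ m₁ m₂ α₂ αt₂, g' ≠ 0 →
      ∃ (hm : MemLp (Lker (fun a b => K b a) ν ⇑g) 2 μ)
        (hm' : MemLp (Lker (fun a b => K b a) ν ⇑g') 2 μ),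
        hm.toLp _ ∈ Gcone μ x₀ m₁ m₂ α₁ αt₁ ∧ hm'.toLp _ ∈ Gcone μ x₀ m₁ m₂ α₁ αt₁ ∧
        hilbertD (Gcone μ x₀ m₁ m₂ α₁ αt₁) (hm.toLp _) (hm'.toLp _)
          ≤ ENNReal.ofReal κ * hilbertD (Gcone ν x₀ m₁ m₂ α₂ αt₂) g g' := by
  obtain ⟨e, he, hinf⟩ := hinf
  obtain ⟨Mb₀, hsup⟩ := hsup
  set Mb : ℝ := max Mb₀ (2 * e) with hMbdef
  have hMb2 : 2 * e ≤ Mb := le_max_right _ _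
  have hMb : 0 < Mb := by linarith
  set η : ℝ := e / Mb with hηdef
  have hη : 0 < η := by positivity
  have hη1 : η ≤ 1 / 2 := by rw [hηdef, div_le_iff₀ hMb]; linarith
  have heη : η * Mb = e := by rw [hηdef]; field_simp
  let T := kerLin μ ν K hKmeas hKpos hKle
  have hinner : ∀ (f : Lp ℝ 2 μ) (g : Lp ℝ 2 ν),
      inner ℝ f (T g) = ∫ x, Lker (fun a b => K b a) ν (⇑g) x * f x ∂μ := by
    intro f g
    rw [inner_eq_int]
    apply integral_congr_ae
    filter_upwards [(lker_memLp μ ν K hKmeas hKpos hKle g).coeFn_toLp] with x hx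
    change f x * ((lker_memLp μ ν K hKmeas hKpos hKle g).toLp _ : X → ℝ) x = _
    rw [hx, mul_comm]
  let ι := {f : Lp ℝ 2 μ // f ∈ Fcone μ x₀ m₁ m₂ α₁ αt₁ ∧ intLin μ f = 1}
  let κ' := {f : Lp ℝ 2 ν // f ∈ Fcone ν x₀ m₁ m₂ α₂ αt₂}
  let φ : ι → Lp ℝ 2 μ →ₗ[ℝ] ℝ := fun i => (innerSL ℝ i.1).toLinearMap
  let ψ : κ' → Lp ℝ 2 ν →ₗ[ℝ] ℝ := fun i => (innerSL ℝ i.1).toLinearMap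
  have hφ : ∀ i z, φ i z = inner ℝ i.1 z := fun i z => rfl
  have hψ : ∀ i z, ψ i z = inner ℝ i.1 z := fun i z => rfl
  have hC : ∀ y, y ∈ Gcone ν x₀ m₁ m₂ α₂ αt₂ ↔ ∀ j, 0 ≤ ψ j y := by
    intro y
    constructor
    · intro h j
      rw [hψ, inner_eq_int]; exact h j.1 j.2
    · intro h f hf
      rw [← inner_eq_int]; exact h ⟨f, hf⟩
  have hD : ∀ z, z ∈ Gcone μ x₀ m₁ m₂ α₁ αt₁ ↔ ∀ i, 0 ≤ φ i z := by
    intro y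
    constructor
    · intro h j
      rw [hφ, inner_eq_int]; exact h j.1 j.2.1
    · intro h f hf
      rw [← inner_eq_int]
      rcases fcone_pos μ x₀ m₁ m₂ hm₁ α₁ αt₁ hα₁pos f hf with h0 | h0
      · simp [h0]
      · have h5 := h ⟨(intLin μ f)⁻¹ • f,
          fcone_smul μ x₀ m₁ m₂ α₁ αt₁ f hf _ (by positivity), by
            rw [map_smul, smul_eq_mul, inv_mul_cancel₀ h0.ne']⟩
        rw [hφ, real_inner_smul_left] at h5
        exact nonneg_of_mul_nonneg_right h5 (by positivity)
  obtain ⟨f₀, hf₀, hf₀1⟩ := fcone_exists μ x₀ m₁ m₂ hm₁ hm₁₂ α₁ αt₁ h1 h2 hμm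
  have hnorm : ∀ y ∈ Gcone ν x₀ m₁ m₂ α₂ αt₂, y ≠ 0 →
      (intLin ν y)⁻¹ • y ∈ Gcone ν x₀ m₁ m₂ α₂ αt₂ ∧ intLin ν ((intLin ν y)⁻¹ • y) = 1 := by
    intro y hy hy0
    have hp : 0 < intLin ν y := hpos y hy hy0
    constructor
    · rw [hC] at hy ⊢
      intro j
      rw [map_smul, smul_eq_mul]
      exact mul_nonneg (by positivity) (hy j)
    · rw [map_smul, smul_eq_mul, inv_mul_cancel₀ hp.ne']
  have key := birkhoff_aux (Gcone ν x₀ m₁ m₂ α₂ αt₂) (Gcone μ x₀ m₁ m₂ α₁ αt₁) ψ φ hC hD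
    ⟨f₀, hf₀, hf₀1⟩ (intLin ν) hpos T η Mb hη hη1 hMb
    (by
      intro i y hy
      by_cases hy0 : y = 0
      · simp [hy0]
      have hp : 0 < intLin ν y := hpos y hy hy0
      have h5 := hinf i.1 i.2.1 i.2.2 _ (hnorm y hy hy0).1 (hnorm y hy hy0).2
      rw [← hinner, map_smul, real_inner_smul_right, le_inv_mul_iff₀ hp] at h5
      rw [hφ, heη]; linarith)
    (by
      intro i y hy
      by_cases hy0 : y = 0
      · simp [hy0]
      have hp : 0 < intLin ν y := hpos y hy hy0
      have h5 := hsup i.1 i.2.1 i.2.2 _ (hnorm y hy hy0).1 (hnorm y hy hy0).2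
      rw [← hinner, map_smul, real_inner_smul_right] at h5
      have h6 := h5.trans (le_max_left Mb₀ (2 * e))
      rw [inv_mul_le_iff₀ hp] at h6
      rw [hφ]; linarith)
  refine ⟨max (1 / 2) (1 - η ^ 5), lt_of_lt_of_le (by norm_num) (le_max_left _ _),
    max_lt (by norm_num) (by have : 0 < η ^ 5 := by positivity
                             linarith), ?_⟩
  intro g hg hg0 g' hg' hg'0
  exact ⟨lker_memLp μ ν K hKmeas hKpos hKle g, lker_memLp μ ν K hKmeas hKpos hKle g',
    key g hg hg0 g' hg' hg'0⟩


end Paper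
end
end

section
/- Let μ, ν be Borel probability measures on 𝒳, c : 𝒳×𝒳 → [0,∞) measurable, ε > 0, and K(x,y) := exp(−c(x,y)/ε). Assume there exist p > 0 and δ > 0 such that lim_{r→∞} ( sup_{x,y ∈ B_r} c(x,y) )/r^p = 0 and lim_{r→∞} max{μ(B_r^c), ν(B_r^c)}/exp(−r^{p+δ}) = 0. For p < p₂ < p₁ < p + δ set α_i(r) := exp(−r^{p_i}), i = 1, 2. Then there exists m̲ > 0 such that for all m₁ = m₂ = m ≥ m̲: for all g, g̃ ∈ 𝒜 := {L_{K^⊤,μ}(ĝ) : ĝ ∈ 𝓖^μ_{α₁,α₁}, ĝ ≥ 0 μ-a.s., ∫ ĝ dμ > 0}, one has d_{𝓖^μ_{α₁,α₁}}(1/g, 1/g̃) ≤ d_{𝓖^μ_{α₂,α₂}}(g, g̃), where 1/g denotes the pointwise inverse S(g). -/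
open MeasureTheory Metric Set Filter
open scoped ENNReal NNReal Topology

noncomputable section

namespace Paper

variable {X : Type*} [MeasurableSpace X] [MetricSpace X] [PolishSpace X] [BorelSpace X]

set_option linter.unusedSectionVars false

/-- function-level version of `Fcone`. -/
def PF (μ : Measure X) (x₀ : X) (m : ℝ) (α : ℝ → ℝ) (f : X → ℝ) : Prop :=
  (∀ᵐ x ∂μ, x ∈ closedBall x₀ m → 0 ≤ f x)
    ∧ (∀ r, m ≤ r → ∫ x in (closedBall x₀ r)ᶜ, max (f x) 0 ∂μ ≤ α r * ∫ x, f x ∂μ)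
    ∧ (∀ r, m ≤ r → ∫ x in (closedBall x₀ r)ᶜ, max (-(f x)) 0 ∂μ ≤ α r * ∫ x, f x ∂μ)

lemma PF.congr {μ : Measure X} {x₀ : X} {m : ℝ} {α : ℝ → ℝ} {f g : X → ℝ}
    (h : PF μ x₀ m α f) (hfg : f =ᵐ[μ] g) : PF μ x₀ m α g := by
  obtain ⟨h1, h2, h3⟩ := h
  refine ⟨?_, ?_, ?_⟩
  · filter_upwards [h1, hfg] with x hx1 hx2
    rw [← hx2]; exact hx1
  · intro r hr
    have e1 : ∫ x in (closedBall x₀ r)ᶜ, max (g x) 0 ∂μ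
        = ∫ x in (closedBall x₀ r)ᶜ, max (f x) 0 ∂μ := by
      apply integral_congr_ae
      filter_upwards [ae_restrict_of_ae hfg] with x hx
      simp only [hx]
    rw [e1, ← integral_congr_ae hfg]; exact h2 r hr
  · intro r hr
    have e1 : ∫ x in (closedBall x₀ r)ᶜ, max (-(g x)) 0 ∂μ
        = ∫ x in (closedBall x₀ r)ᶜ, max (-(f x)) 0 ∂μ := by
      apply integral_congr_ae
      filter_upwards [ae_restrict_of_ae hfg] with x hx
      simp only [hx]
    rw [e1, ← integral_congr_ae hfg]; exact h3 r hr

lemma Gcone_apply {μ : Measure X} {x₀ : X} {m : ℝ} {α : ℝ → ℝ} {g : Lp ℝ 2 μ}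
    (hg : g ∈ Gcone μ x₀ m m α α) {f : X → ℝ} (hf : MemLp f 2 μ) (h : PF μ x₀ m α f) :
    0 ≤ ∫ x, f x * g x ∂μ := by
  have h1 : PF μ x₀ m α (hf.toLp f) := h.congr hf.coeFn_toLp.symm
  have h2 := hg (hf.toLp f) h1
  refine h2.trans_eq (integral_congr_ae ?_)
  filter_upwards [hf.coeFn_toLp] with x hx
  rw [hx]

lemma tail_lint (ρ : Measure X) (x₀ : X) (m p I : ℝ) (α₁ α₂ : ℝ → ℝ) (hI : 0 ≤ I) (hm : 1 ≤ m)
    (hp : 0 < p) (h : ∀ r, m ≤ r → ρ (closedBall x₀ r)ᶜ ≤ ENNReal.ofReal (α₁ r * I))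
    (ha : ∀ s, m ≤ s → Real.exp ((2 * s) ^ p) * α₁ s ≤ 1 / 32 * α₂ s)
    (hb : ∀ s, m ≤ s → α₂ (2 * s) ≤ α₂ s / 2) (h2 : ∀ s, 0 ≤ α₂ s) (r : ℝ) (hr : m ≤ r) :
    ∫⁻ x in (closedBall x₀ r)ᶜ, ENNReal.ofReal (Real.exp (dist x x₀ ^ p)) ∂ρ
      ≤ ENNReal.ofReal (1 / 16 * α₂ r * I) := by
  have key : ∀ n : ℕ, ∀ r, m ≤ r →
      ∫⁻ x in (closedBall x₀ r)ᶜ ∩ closedBall x₀ (2 ^ n * r),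
        ENNReal.ofReal (Real.exp (dist x x₀ ^ p)) ∂ρ ≤ ENNReal.ofReal (1 / 16 * α₂ r * I) := by
    intro n
    induction n with
    | zero => intro r hr; simp
    | succ n ih =>
      intro r hr
      have hsub : (closedBall x₀ r)ᶜ ∩ closedBall x₀ (2 ^ (n + 1) * r) ⊆
          ((closedBall x₀ r)ᶜ ∩ closedBall x₀ (2 * r)) ∪
          ((closedBall x₀ (2 * r))ᶜ ∩ closedBall x₀ (2 ^ n * (2 * r))) := by
        intro x hx
        have e : (2 : ℝ) ^ (n + 1) * r = 2 ^ n * (2 * r) := by ring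
        rw [e] at hx
        by_cases h : x ∈ closedBall x₀ (2 * r)
        · exact Or.inl ⟨hx.1, h⟩
        · exact Or.inr ⟨h, hx.2⟩
      have b1 : ∫⁻ x in (closedBall x₀ r)ᶜ ∩ closedBall x₀ (2 * r),
          ENNReal.ofReal (Real.exp (dist x x₀ ^ p)) ∂ρ
          ≤ ENNReal.ofReal (1 / 32 * α₂ r * I) := by
        calc _ ≤ ∫⁻ x in (closedBall x₀ r)ᶜ ∩ closedBall x₀ (2 * r),
              ENNReal.ofReal (Real.exp ((2 * r) ^ p)) ∂ρ := by
              apply setLIntegral_mono' (by measurability)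
              intro x hx
              apply ENNReal.ofReal_le_ofReal
              apply Real.exp_le_exp.mpr
              exact Real.rpow_le_rpow dist_nonneg hx.2 hp.le
          _ = ENNReal.ofReal (Real.exp ((2 * r) ^ p)) *
              ρ ((closedBall x₀ r)ᶜ ∩ closedBall x₀ (2 * r)) := by
              rw [setLIntegral_const]
          _ ≤ ENNReal.ofReal (Real.exp ((2 * r) ^ p)) * ENNReal.ofReal (α₁ r * I) := by
              gcongr
              exact (measure_mono inter_subset_left).trans (h r hr)
          _ ≤ _ := by
              rw [← ENNReal.ofReal_mul (Real.exp_pos _).le]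
              apply ENNReal.ofReal_le_ofReal
              have := mul_le_mul_of_nonneg_right (ha r hr) hI
              linarith
      have b2 := ih (2 * r) (by linarith)
      calc _ ≤ _ := lintegral_mono_set hsub
        _ ≤ _ := lintegral_union_le _ _ _
        _ ≤ _ := add_le_add b1 b2
        _ ≤ _ := by
          rw [← ENNReal.ofReal_add]
          · apply ENNReal.ofReal_le_ofReal
            have := mul_le_mul_of_nonneg_right (hb r hr) hI
            linarith
          · have := mul_nonneg (h2 r) hI; linarith
          · have := mul_nonneg (h2 (2 * r)) hI; linarith
  have hU : (closedBall x₀ r)ᶜ = ⋃ n : ℕ, (closedBall x₀ r)ᶜ ∩ closedBall x₀ (2 ^ n * r) := by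
    rw [← inter_iUnion]
    symm
    apply inter_eq_left.mpr
    intro x _
    rw [mem_iUnion]
    obtain ⟨n, hn⟩ := pow_unbounded_of_one_lt (dist x x₀) (one_lt_two : (1 : ℝ) < 2)
    refine ⟨n, ?_⟩
    rw [mem_closedBall]
    have : (0 : ℝ) < 2 ^ n := by positivity
    nlinarith
  rw [hU, setLIntegral_iUnion_of_directed]
  · exact iSup_le fun n => key n r hr
  · apply Monotone.directed_le
    intro a b hab
    apply inter_subset_inter_right
    apply closedBall_subset_closedBall
    gcongr
    · linarith
    · norm_num

lemma tail_int (μ : Measure X) [IsProbabilityMeasure μ] (x₀ : X) (m p I : ℝ) (α₁ α₂ : ℝ → ℝ)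
    (hI : 0 ≤ I) (hm : 1 ≤ m) (hp : 0 < p)
    (ha : ∀ s, m ≤ s → Real.exp ((2 * s) ^ p) * α₁ s ≤ 1 / 32 * α₂ s)
    (hb : ∀ s, m ≤ s → α₂ (2 * s) ≤ α₂ s / 2) (h2 : ∀ s, 0 ≤ α₂ s)
    (k W : X → ℝ) (hkm : Measurable k) (hk0 : ∀ x, 0 ≤ k x) (hki : Integrable k μ)
    (hk : ∀ r, m ≤ r → ∫ x in (closedBall x₀ r)ᶜ, k x ∂μ ≤ α₁ r * I)
    (hWm : Measurable W) (hW0 : ∀ x, 0 ≤ W x)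
    (hW : ∀ x, x ∉ closedBall x₀ m → W x ≤ 4 * (k x * Real.exp (dist x x₀ ^ p)))
    (r : ℝ) (hr : m ≤ r) :
    ∫ x in (closedBall x₀ r)ᶜ, W x ∂μ ≤ 1 / 4 * α₂ r * I := by
  have hms : ∀ r, MeasurableSet (closedBall x₀ r)ᶜ := fun r => by measurability
  have hd : Measurable fun x : X => ENNReal.ofReal (Real.exp (dist x x₀ ^ p)) := by fun_prop
  have h1 := tail_lint (μ.withDensity fun x => ENNReal.ofReal (k x)) x₀ m p I α₁ α₂ hI hm hp
    (by
      intro r hr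
      rw [withDensity_apply _ (hms r), ← ofReal_integral_eq_lintegral_ofReal hki.restrict
        (Eventually.of_forall hk0)]
      exact ENNReal.ofReal_le_ofReal (hk r hr)) ha hb h2 r hr
  rw [setLIntegral_withDensity_eq_setLIntegral_mul _ (by fun_prop) hd (hms r)] at h1
  have hnn : 0 ≤ 1 / 16 * α₂ r * I := by have := mul_nonneg (h2 r) hI; linarith
  rw [integral_eq_lintegral_of_nonneg_ae (Eventually.of_forall hW0) hWm.aestronglyMeasurable]
  apply ENNReal.toReal_le_of_le_ofReal (by linarith)
  calc ∫⁻ x in (closedBall x₀ r)ᶜ, ENNReal.ofReal (W x) ∂μ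
      ≤ ∫⁻ x in (closedBall x₀ r)ᶜ, ENNReal.ofReal 4 * ((fun x => ENNReal.ofReal (k x)) *
          fun x => ENNReal.ofReal (Real.exp (dist x x₀ ^ p))) x ∂μ := by
        apply setLIntegral_mono' (hms r)
        intro x hx
        simp only [Pi.mul_apply]
        rw [← ENNReal.ofReal_mul (hk0 x), ← ENNReal.ofReal_mul (by norm_num)]
        apply ENNReal.ofReal_le_ofReal
        exact hW x fun h => hx (closedBall_subset_closedBall hr h)
    _ = ENNReal.ofReal 4 * _ := lintegral_const_mul _ (by fun_prop)
    _ ≤ ENNReal.ofReal 4 * ENNReal.ofReal (1 / 16 * α₂ r * I) := by gcongr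
    _ = _ := by
      rw [← ENNReal.ofReal_mul (by norm_num)]
      congr 1; ring

lemma hilbert_le {Y Z : Type*} [AddCommGroup Y] [Module ℝ Y] [AddCommGroup Z] [Module ℝ Z]
    (C : Set Y) (D : Set Z) (u u' : Y) (v v' : Z) (hu' : u' ≠ 0)
    (hA : ∀ a : ℝ, 0 < a → v - a • v' ∈ D → a⁻¹ • u' - u ∈ C)
    (hB : ∀ b : ℝ, 0 < b → b • v' - v ∈ D → u - b⁻¹ • u' ∈ C)
    (K k : ℝ) (hk : 0 < k) (hK : ∀ a : ℝ, 0 < a → v - a • v' ∈ D → a ≤ K)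
    (hk' : ∀ b : ℝ, 0 < b → b • v' - v ∈ D → k ≤ b) :
    hilbertD C u u' ≤ hilbertD D v v' := by
  unfold hilbertD
  by_cases h : simC D v v' ∧ v' ≠ 0
  · obtain ⟨⟨⟨a, ha, hav⟩, ⟨b, hb, hbv⟩⟩, -⟩ := id h
    have hs : simC C u u' :=
      ⟨⟨b⁻¹, inv_pos.mpr hb, hB b hb hbv⟩, ⟨a⁻¹, inv_pos.mpr ha, hA a ha hav⟩⟩
    rw [if_pos h, if_pos ⟨hs, hu'⟩]
    have hm2 : 0 < minf D v v' :=
      ha.trans_le (le_csSup ⟨K, fun a ha => hK a ha.1 ha.2⟩ ⟨ha, hav⟩)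
    have hM2 : k ≤ Msup D v v' := le_csInf ⟨b, hb, hbv⟩ fun b hb => hk' b hb.1 hb.2
    have hM2' : 0 < Msup D v v' := hk.trans_le hM2
    have hM1 : Msup C u u' ≤ (minf D v v')⁻¹ := by
      by_cases h0 : Msup C u u' ≤ 0
      · exact h0.trans (inv_pos.mpr hm2).le
      push Not at h0
      rw [le_inv_comm₀ h0 hm2]
      refine csSup_le ⟨a, ha, hav⟩ ?_
      rintro a ⟨ha, hav⟩
      rw [le_inv_comm₀ ha h0]
      exact csInf_le ⟨0, fun b hb => hb.1.le⟩ ⟨inv_pos.mpr ha, hA a ha hav⟩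
    have hM1n : 0 ≤ Msup C u u' := Real.sInf_nonneg fun b hb => hb.1.le
    have hm1n : 0 ≤ minf C u u' := Real.sSup_nonneg fun b hb => hb.1.le
    rcases hM1n.eq_or_lt with h0 | h0
    · simp [← h0]
    rcases hm1n.eq_or_lt with h0' | h0'
    · simp [← h0']
    have hbd : BddAbove {a : ℝ | 0 < a ∧ u - a • u' ∈ C} := by
      by_contra hcon
      unfold minf at h0'
      rw [Real.sSup_of_not_bddAbove hcon] at h0'
      exact lt_irrefl _ h0'
    have hm1 : (Msup D v v')⁻¹ ≤ minf C u u' := by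
      rw [inv_le_comm₀ hM2' h0']
      refine le_csInf ⟨b, hb, hbv⟩ ?_
      rintro b ⟨hb, hbv⟩
      rw [inv_le_comm₀ h0' hb]
      exact le_csSup hbd ⟨inv_pos.mpr hb, hB b hb hbv⟩
    apply ENNReal.ofReal_le_ofReal
    apply Real.log_le_log (by positivity)
    calc Msup C u u' / minf C u u' ≤ (minf D v v')⁻¹ / (Msup D v v')⁻¹ := by
          gcongr
      _ = _ := by field_simp
  · rw [if_neg h]; exact le_top

/-- the collection of conditions on large m. -/
structure Good (μ : Measure X) (x₀ : X) (c : X → X → ℝ) (ε p : ℝ) (α₁ α₂ : ℝ → ℝ) (m : ℝ) :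
    Prop where
  hm : 1 ≤ m
  hc : ∀ s, m ≤ s → ∀ x ∈ closedBall x₀ s, ∀ y ∈ closedBall x₀ s, c x y ≤ ε / 2 * s ^ p
  hμ : ∀ s, m ≤ s → (μ (closedBall x₀ s)ᶜ).toReal ≤ 1 / 2 * α₁ s
  hα : ∀ s, m ≤ s → α₁ s ≤ 1 / 4
  ha : ∀ s, m ≤ s → Real.exp ((2 * s) ^ p) * α₁ s ≤ 1 / 32 * α₂ s
  hb : ∀ s, m ≤ s → α₂ (2 * s) ≤ α₂ s / 2
  h1 : ∀ s, 0 < α₁ s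
  h2 : ∀ s, 0 < α₂ s
  h3 : ∀ s, m ≤ s → α₂ s ≤ 1

lemma pow_dom (q q' C : ℝ) (h : q < q') : ∀ᶠ s : ℝ in atTop, C * s ^ q ≤ s ^ q' := by
  filter_upwards [(tendsto_rpow_atTop (sub_pos.mpr h)).eventually_ge_atTop C, eventually_gt_atTop 0]
    with s hs h0
  calc C * s ^ q ≤ s ^ (q' - q) * s ^ q := by gcongr
    _ = s ^ q' := by rw [← Real.rpow_add h0]; congr 1; ring

lemma exists_good (μ ν : Measure X) [IsProbabilityMeasure μ] [IsProbabilityMeasure ν]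
    (x₀ : X) (c : X → X → ℝ) (ε : ℝ) (hε : 0 < ε)
    (p δ : ℝ) (hp : 0 < p)
    (hcbdd : ∀ r : ℝ,
      BddAbove {v : ℝ | ∃ x ∈ closedBall x₀ r, ∃ y ∈ closedBall x₀ r, v = c x y})
    (hclim : Tendsto (fun r : ℝ =>
        sSup {v : ℝ | ∃ x ∈ closedBall x₀ r, ∃ y ∈ closedBall x₀ r, v = c x y} / r ^ p)
      atTop (𝓝 0))
    (htaillim : Tendsto (fun r : ℝ =>
        max (μ ((closedBall x₀ r)ᶜ)).toReal (ν ((closedBall x₀ r)ᶜ)).toReal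
          / Real.exp (-r ^ (p + δ))) atTop (𝓝 0))
    (p₁ p₂ : ℝ) (hpp₂ : p < p₂) (hp₂p₁ : p₂ < p₁) (hp₁ : p₁ < p + δ) :
    ∃ mlow : ℝ, 0 < mlow ∧ ∀ m : ℝ, mlow ≤ m →
      Good μ x₀ c ε p (fun r => Real.exp (-r ^ p₁)) (fun r => Real.exp (-r ^ p₂)) m := by
  have e1 : ∀ᶠ s : ℝ in atTop, ∀ x ∈ closedBall x₀ s, ∀ y ∈ closedBall x₀ s,
      c x y ≤ ε / 2 * s ^ p := by
    filter_upwards [hclim.eventually_lt_const (half_pos hε), eventually_gt_atTop 0] with s hs h0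
    intro x hx y hy
    rw [div_lt_iff₀ (Real.rpow_pos_of_pos h0 _)] at hs
    exact (le_csSup (hcbdd s) ⟨x, hx, y, hy, rfl⟩).trans hs.le
  have t1 : Tendsto (fun s : ℝ => s ^ p₁) atTop atTop := tendsto_rpow_atTop (by linarith)
  have t2 : Tendsto (fun s : ℝ => s ^ p₂) atTop atTop := tendsto_rpow_atTop (by linarith)
  have e2 : ∀ᶠ s : ℝ in atTop,
      (μ (closedBall x₀ s)ᶜ).toReal ≤ 1 / 2 * Real.exp (-s ^ p₁) := by
    filter_upwards [htaillim.eventually_lt_const one_pos, pow_dom p₁ (p + δ) 2 hp₁,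
      t1.eventually_ge_atTop (Real.log 2)] with s h1 h2 h3
    rw [div_lt_one (Real.exp_pos _)] at h1
    calc _ ≤ _ := le_max_left _ _
      _ ≤ _ := h1.le
      _ ≤ Real.exp (-Real.log 2 + -s ^ p₁) := Real.exp_le_exp.mpr (by linarith)
      _ = _ := by rw [Real.exp_add, Real.exp_neg, Real.exp_log (by norm_num)]; norm_num
  have e3 : ∀ᶠ s : ℝ in atTop, Real.exp (-s ^ p₁) ≤ 1 / 4 := by
    filter_upwards [t1.eventually_ge_atTop (Real.log 4)] with s h
    calc _ ≤ Real.exp (-Real.log 4) := Real.exp_le_exp.mpr (by linarith)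
      _ = _ := by rw [Real.exp_neg, Real.exp_log (by norm_num)]; norm_num
  have e4 : ∀ᶠ s : ℝ in atTop, Real.exp ((2 * s) ^ p) * Real.exp (-s ^ p₁)
      ≤ 1 / 32 * Real.exp (-s ^ p₂) := by
    filter_upwards [pow_dom p p₁ (3 * 2 ^ p) (by linarith), pow_dom p₂ p₁ 3 hp₂p₁,
      t1.eventually_ge_atTop (3 * Real.log 32), eventually_ge_atTop 0] with s h1 h2 h3 h0
    rw [← Real.exp_add, Real.mul_rpow (by norm_num) h0]
    calc _ ≤ Real.exp (-Real.log 32 + -s ^ p₂) := Real.exp_le_exp.mpr (by linarith)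
      _ = _ := by rw [Real.exp_add, Real.exp_neg, Real.exp_log (by norm_num)]; norm_num
  have e5 : ∀ᶠ s : ℝ in atTop, Real.exp (-(2 * s) ^ p₂) ≤ Real.exp (-s ^ p₂) / 2 := by
    have h2 : (1 : ℝ) < 2 ^ p₂ := Real.one_lt_rpow (by norm_num) (by linarith)
    have h3 : 0 < (2 : ℝ) ^ p₂ - 1 := by linarith
    filter_upwards [t2.eventually_ge_atTop (Real.log 2 / (2 ^ p₂ - 1)), eventually_ge_atTop 0]
      with s h1 h0
    rw [div_le_iff₀ h3] at h1
    rw [Real.mul_rpow (by norm_num) h0]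
    calc _ ≤ Real.exp (-Real.log 2 + -s ^ p₂) := Real.exp_le_exp.mpr (by linarith)
      _ = _ := by rw [Real.exp_add, Real.exp_neg, Real.exp_log (by norm_num)]; ring
  obtain ⟨M, hM⟩ := eventually_atTop.mp (e1.and (e2.and (e3.and (e4.and e5))))
  refine ⟨max M 1, by positivity, fun m hm => ?_⟩
  have hmM : M ≤ m := (le_max_left _ _).trans hm
  have hm1 : 1 ≤ m := (le_max_right _ _).trans hm
  constructor
  · exact hm1
  · exact fun s hs => (hM s (hmM.trans hs)).1
  · exact fun s hs => (hM s (hmM.trans hs)).2.1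
  · exact fun s hs => (hM s (hmM.trans hs)).2.2.1
  · exact fun s hs => (hM s (hmM.trans hs)).2.2.2.1
  · exact fun s hs => (hM s (hmM.trans hs)).2.2.2.2
  · exact fun s => Real.exp_pos _
  · exact fun s => Real.exp_pos _
  · intro s hs
    apply Real.exp_le_one_iff.mpr
    have : 0 ≤ s ^ p₂ := Real.rpow_nonneg (by linarith) _
    linarith

section
variable {μ : Measure X} [IsProbabilityMeasure μ] {x₀ : X} {c : X → X → ℝ} {ε p : ℝ}
  {α₁ α₂ : ℝ → ℝ} {m : ℝ}

lemma Lp_int (g : Lp ℝ 2 μ) : Integrable g μ := (Lp.memLp g).integrable (by norm_num)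

lemma Good.real (H : Good μ x₀ c ε p α₁ α₂ m) : 3 / 4 ≤ μ.real (closedBall x₀ m) := by
  have h1 := H.hμ m le_rfl
  have h2 := H.hα m le_rfl
  have h3 : μ.real (closedBall x₀ m)ᶜ = 1 - μ.real (closedBall x₀ m) :=
    probReal_compl_eq_one_sub (by measurability)
  rw [← measureReal_def] at h1
  linarith

lemma Good.half (H : Good μ x₀ c ε p α₁ α₂ m) {g : Lp ℝ 2 μ} (hg : g ∈ Gcone μ x₀ m m α₁ α₁) :
    (∫ x, g x ∂μ) / 2 ≤ ∫ x in closedBall x₀ m, g x ∂μ := by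
  set B := closedBall x₀ m with hB
  have hBm : MeasurableSet B := by measurability
  set F : X → ℝ := fun x => B.indicator (fun _ => (2 : ℝ)) x - 1 with hF
  have hFm : Measurable F := (measurable_const.indicator hBm).sub_const 1
  have hFL : MemLp F 2 μ := by
    refine MemLp.of_bound hFm.aestronglyMeasurable 1 (Eventually.of_forall fun x => ?_)
    simp only [hF]
    by_cases hx : x ∈ B <;> simp [hx] <;> norm_num
  have hFI : ∫ x, F x ∂μ = 2 * μ.real B - 1 := by
    simp only [hF]
    rw [integral_sub ((integrable_const _).indicator hBm) (integrable_const _),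
      integral_indicator_const _ hBm]
    simp; ring
  have hr := H.real
  have hPF : PF μ x₀ m α₁ F := by
    refine ⟨Eventually.of_forall fun x hx => ?_, ?_, ?_⟩
    · simp [hF, hB, hx]
    · intro r hr'
      have : ∫ x in (closedBall x₀ r)ᶜ, max (F x) 0 ∂μ = 0 := by
        rw [setIntegral_congr_fun (g := fun _ => (0 : ℝ)) (by measurability)]
        · simp
        · intro x hx
          have : x ∉ B := fun h => hx (closedBall_subset_closedBall hr' h)
          simp [hF, this]
      rw [this, hFI]
      exact mul_nonneg (H.h1 r).le (by linarith)
    · intro r hr'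
      have : ∫ x in (closedBall x₀ r)ᶜ, max (-F x) 0 ∂μ = μ.real (closedBall x₀ r)ᶜ := by
        rw [setIntegral_congr_fun (g := fun _ => (1 : ℝ)) (by measurability)]
        · simp
        · intro x hx
          have : x ∉ B := fun h => hx (closedBall_subset_closedBall hr' h)
          simp [hF, this]
      rw [this, hFI]
      have h1 := H.hμ r hr'
      rw [← measureReal_def] at h1
      have := H.h1 r
      nlinarith
  have h := Gcone_apply hg hFL hPF
  have e : ∫ x, F x * g x ∂μ = 2 * ∫ x in B, g x ∂μ - ∫ x, g x ∂μ := by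
    rw [← integral_indicator hBm, ← integral_const_mul,
      ← integral_sub (((Lp_int g).indicator hBm).const_mul 2) (Lp_int g)]
    apply integral_congr_ae
    refine Eventually.of_forall fun x => ?_
    by_cases hx : x ∈ B <;> simp [hF, hx] <;> ring
  linarith

lemma L_meas (hcmeas : Measurable (Function.uncurry c)) (g : Lp ℝ 2 μ) :
    Measurable (Lker (fun a b => Real.exp (-c b a / ε)) μ g) := by
  have hg : Measurable g := (Lp.stronglyMeasurable g).measurable
  have hc : Measurable fun q : X × X => c q.2 q.1 :=
    hcmeas.comp (measurable_snd.prodMk measurable_fst)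
  have : StronglyMeasurable fun q : X × X => Real.exp (-c q.2 q.1 / ε) * g q.2 := by
    apply Measurable.stronglyMeasurable
    fun_prop
  exact this.integral_prod_right.measurable

lemma K_int (hcmeas : Measurable (Function.uncurry c)) (hcnn : ∀ x y, 0 ≤ c x y) (hε : 0 < ε)
    (g : Lp ℝ 2 μ) (x : X) : Integrable (fun y => Real.exp (-c y x / ε) * g y) μ := by
  have hg : Measurable g := (Lp.stronglyMeasurable g).measurable
  have hc : Measurable fun y : X => c y x := hcmeas.comp (measurable_id.prodMk measurable_const)
  refine (Lp_int g).mono (by fun_prop) (Eventually.of_forall fun y => ?_)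
  rw [norm_mul, Real.norm_of_nonneg (Real.exp_pos _).le]
  refine mul_le_of_le_one_left (norm_nonneg _) (Real.exp_le_one_iff.mpr ?_)
  exact div_nonpos_of_nonpos_of_nonneg (by linarith [hcnn y x]) hε.le

lemma L_le (hcmeas : Measurable (Function.uncurry c)) (hcnn : ∀ x y, 0 ≤ c x y) (hε : 0 < ε)
    (g : Lp ℝ 2 μ) (hg0 : ∀ᵐ x ∂μ, 0 ≤ g x) (x : X) :
    Lker (fun a b => Real.exp (-c b a / ε)) μ g x ≤ ∫ y, g y ∂μ := by
  refine integral_mono_ae (K_int hcmeas hcnn hε g x) (Lp_int g) ?_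
  filter_upwards [hg0] with y hy
  refine mul_le_of_le_one_left hy (Real.exp_le_one_iff.mpr ?_)
  exact div_nonpos_of_nonpos_of_nonneg (by linarith [hcnn y x]) hε.le

lemma L_ge (H : Good μ x₀ c ε p α₁ α₂ m)
    (hcmeas : Measurable (Function.uncurry c)) (hcnn : ∀ x y, 0 ≤ c x y) (hε : 0 < ε)
    {g : Lp ℝ 2 μ} (hg : g ∈ Gcone μ x₀ m m α₁ α₁) (hg0 : ∀ᵐ x ∂μ, 0 ≤ g x)
    (s : ℝ) (hs : m ≤ s) (x : X) (hx : x ∈ closedBall x₀ s) :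
    Real.exp (-(s ^ p / 2)) * ((∫ y, g y ∂μ) / 2) ≤
      Lker (fun a b => Real.exp (-c b a / ε)) μ g x := by
  have hsub := closedBall_subset_closedBall (x := x₀) hs
  calc _ ≤ Real.exp (-(s ^ p / 2)) * ∫ y in closedBall x₀ m, g y ∂μ := by
        gcongr; exact H.half hg
    _ = ∫ y in closedBall x₀ m, Real.exp (-(s ^ p / 2)) * g y ∂μ := by
        rw [integral_const_mul]
    _ ≤ ∫ y in closedBall x₀ m, Real.exp (-c y x / ε) * g y ∂μ := by
        refine setIntegral_mono_on_ae ((Lp_int g).const_mul _).integrableOn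
          (K_int hcmeas hcnn hε g x).integrableOn (by measurability) ?_
        filter_upwards [hg0] with y hy hyB
        gcongr
        have := H.hc s hs y (hsub hyB) x hx
        rw [le_div_iff₀ hε]
        nlinarith
    _ ≤ _ := by
        refine setIntegral_le_integral (K_int hcmeas hcnn hε g x) ?_
        filter_upwards [hg0] with y hy
        exact mul_nonneg (Real.exp_pos _).le hy

lemma L_pos (H : Good μ x₀ c ε p α₁ α₂ m)
    (hcmeas : Measurable (Function.uncurry c)) (hcnn : ∀ x y, 0 ≤ c x y) (hε : 0 < ε)
    {g : Lp ℝ 2 μ} (hg : g ∈ Gcone μ x₀ m m α₁ α₁) (hg0 : ∀ᵐ x ∂μ, 0 ≤ g x)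
    (hgp : 0 < ∫ x, g x ∂μ) (x : X) : 0 < Lker (fun a b => Real.exp (-c b a / ε)) μ g x :=
  lt_of_lt_of_le (by positivity) (L_ge H hcmeas hcnn hε hg hg0 (max m (dist x x₀))
    (le_max_left _ _) x (mem_closedBall.mpr (le_max_right _ _)))

/-- the two-sided bounds on a function in the image of the kernel operator. -/
structure Bd (x₀ : X) (m p : ℝ) (u : X → ℝ) (U : ℝ) : Prop where
  meas : Measurable u
  pos : ∀ x, 0 < u x
  le : ∀ x, u x ≤ U
  ge : ∀ s, m ≤ s → ∀ x ∈ closedBall x₀ s, Real.exp (-(s ^ p / 2)) * (U / 2) ≤ u x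

lemma Bd.Upos {u : X → ℝ} {U : ℝ} (hu : Bd x₀ m p u U) : 0 < U := (hu.pos x₀).trans_le (hu.le x₀)

lemma Bd.inv_le {u : X → ℝ} {U : ℝ} (hu : Bd x₀ m p u U) {s : ℝ} (hs : m ≤ s) {x : X}
    (hx : x ∈ closedBall x₀ s) : U / u x ≤ 2 * Real.exp (s ^ p / 2) := by
  have h := hu.ge s hs x hx
  have hp := hu.pos x
  rw [div_le_iff₀ hp]
  have e : Real.exp (s ^ p / 2) * Real.exp (-(s ^ p / 2)) = 1 := by
    rw [← Real.exp_add]; simp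
  calc U = 2 * Real.exp (s ^ p / 2) * (Real.exp (-(s ^ p / 2)) * (U / 2)) := by
        linear_combination (-U) * e
    _ ≤ _ := by gcongr

lemma Bd.H_le {u v : X → ℝ} {U V : ℝ} (hu : Bd x₀ m p u U) (hv : Bd x₀ m p v V)
    {s : ℝ} (hs : m ≤ s) {x : X}
    (hx : x ∈ closedBall x₀ s) : U / u x * (V / v x) ≤ 4 * Real.exp (s ^ p) := by
  have h1 := hu.inv_le hs hx
  have h2 := hv.inv_le hs hx
  have h3 := hv.pos x
  have h4 := hv.Upos
  calc _ ≤ 2 * Real.exp (s ^ p / 2) * (2 * Real.exp (s ^ p / 2)) := by gcongr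
    _ = 4 * (Real.exp (s ^ p / 2) * Real.exp (s ^ p / 2)) := by ring
    _ = _ := by rw [← Real.exp_add]; congr 2; ring

lemma Bd.one_le {u : X → ℝ} {U : ℝ} (hu : Bd x₀ m p u U) (x : X) : 1 ≤ U / u x := by
  rw [one_le_div (hu.pos x)]; exact hu.le x

lemma Bd.memLp {u : X → ℝ} {U : ℝ} (hu : Bd x₀ m p u U) : MemLp u 2 μ := by
  refine MemLp.of_bound hu.meas.aestronglyMeasurable U (Eventually.of_forall fun x => ?_)
  rw [Real.norm_of_nonneg (hu.pos x).le]
  exact hu.le x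

lemma Bd.memLp_inv {u : X → ℝ} {U : ℝ} (H : Good μ x₀ c ε p α₁ α₂ m) (hp : 0 < p)
    (hu : Bd x₀ m p u U) : MemLp (fun x => (u x)⁻¹) 2 μ := by
  have hum := hu.meas
  have hU := hu.Upos
  have hBm : MeasurableSet (closedBall x₀ m)ᶜ := by measurability
  have h1 := tail_lint μ x₀ m p 1 α₁ α₂ zero_le_one H.hm hp
    (by
      intro r hr
      rw [← ENNReal.ofReal_toReal (measure_ne_top μ (closedBall x₀ r)ᶜ)]
      apply ENNReal.ofReal_le_ofReal
      have := H.hμ r hr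
      have := H.h1 r
      linarith) H.ha H.hb (fun s => (H.h2 s).le) m le_rfl
  have hi : IntegrableOn (fun x => Real.exp (dist x x₀ ^ p)) (closedBall x₀ m)ᶜ μ := by
    have hd : Measurable fun x : X => Real.exp (dist x x₀ ^ p) := by fun_prop
    refine ⟨hd.aestronglyMeasurable, ?_⟩
    rw [hasFiniteIntegral_iff_ofReal (Eventually.of_forall fun x => (Real.exp_pos _).le)]
    exact h1.trans_lt ENNReal.ofReal_lt_top
  have hi2 := (((integrable_const (μ := μ) (Real.exp (m ^ p))).add
    (hi.integrable_indicator hBm)).const_mul (4 / U ^ 2))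
  rw [memLp_two_iff_integrable_sq (by fun_prop)]
  refine hi2.mono' (by fun_prop) (Eventually.of_forall fun x => ?_)
  rw [Real.norm_of_nonneg (by positivity)]
  have hpos := hu.pos x
  have e : (u x)⁻¹ ^ 2 = 1 / U ^ 2 * (U / u x * (U / u x)) := by field_simp
  have e2 : ∀ t : ℝ, 4 / U ^ 2 * t = 1 / U ^ 2 * (4 * t) := fun t => by ring
  rw [e, e2]
  refine mul_le_mul_of_nonneg_left ?_ (by positivity)
  by_cases hx : x ∈ closedBall x₀ m
  · refine (hu.H_le hu le_rfl hx).trans ?_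
    simp [hx]
  · have hx' : m ≤ dist x x₀ := by
      rw [mem_closedBall, not_le] at hx; exact hx.le
    refine (hu.H_le hu hx' (mem_closedBall.mpr le_rfl)).trans ?_
    have hx2 : x ∈ (closedBall x₀ m)ᶜ := hx
    simp only [Pi.add_apply, indicator_of_mem hx2]
    have := Real.exp_pos (m ^ p)
    linarith

lemma key (H : Good μ x₀ c ε p α₁ α₂ m) (hp : 0 < p) {u v : X → ℝ} {U V : ℝ}
    (hu : Bd x₀ m p u U) (hv : Bd x₀ m p v V) (f : Lp ℝ 2 μ) (hf : f ∈ Fcone μ x₀ m m α₁ α₁)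
    (R : ℝ) (hR : m ≤ R) :
    MemLp ((closedBall x₀ R).indicator fun x => f x * (U / u x * (V / v x))) 2 μ ∧
    PF μ x₀ m α₂ ((closedBall x₀ R).indicator fun x => f x * (U / u x * (V / v x))) := by
  obtain ⟨hf1, hf2, hf3⟩ := hf
  have hfm : Measurable f := (Lp.stronglyMeasurable f).measurable
  have hum := hu.meas
  have hvm := hv.meas
  set W : X → ℝ := fun x => U / u x * (V / v x) with hW
  have hWm : Measurable W := by fun_prop
  have hW1 : ∀ x, 1 ≤ W x := fun x => one_le_mul_of_one_le_of_one_le (hu.one_le x) (hv.one_le x)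
  have hWle : ∀ s, m ≤ s → ∀ x ∈ closedBall x₀ s, W x ≤ 4 * Real.exp (s ^ p) :=
    fun s hs x hx => hu.H_le hv hs hx
  have hms : ∀ r, MeasurableSet (closedBall x₀ r) := fun r => by measurability
  set F : X → ℝ := (closedBall x₀ R).indicator fun x => f x * W x with hF
  have hFm : Measurable F := (hfm.mul hWm).indicator (hms R)
  have hFL : MemLp F 2 μ := by
    refine MemLp.of_le_mul (c := 4 * Real.exp (R ^ p)) (Lp.memLp f) hFm.aestronglyMeasurable
      (Eventually.of_forall fun x => ?_)
    by_cases hx : x ∈ closedBall x₀ R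
    · simp only [hF, indicator_of_mem hx]
      rw [norm_mul, mul_comm, Real.norm_of_nonneg (by linarith [hW1 x])]
      gcongr
      exact hWle R hR x hx
    · simp only [hF, indicator_of_notMem hx, norm_zero]
      positivity
  have hFi : Integrable F μ := hFL.integrable (by norm_num)
  refine ⟨hFL, ?_⟩
  set I := ∫ x, f x ∂μ with hIdef
  have hI : 0 ≤ I := by
    have h := hf2 m le_rfl
    have h0 : 0 ≤ ∫ x in (closedBall x₀ m)ᶜ, max (f x) 0 ∂μ :=
      integral_nonneg fun x => le_max_right _ _
    exact nonneg_of_mul_nonneg_right (h0.trans h) (H.h1 m)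
  have hpt : ∀ x, x ∉ closedBall x₀ m → W x ≤ 4 * Real.exp (dist x x₀ ^ p) := by
    intro x hx
    rw [mem_closedBall, not_le] at hx
    exact hWle _ hx.le x (mem_closedBall.mpr le_rfl)
  have T1 : ∀ r, m ≤ r → ∫ x in (closedBall x₀ r)ᶜ, max (F x) 0 ∂μ ≤ 1 / 4 * α₂ r * I := by
    refine tail_int μ x₀ m p I α₁ α₂ hI H.hm hp H.ha H.hb (fun s => (H.h2 s).le)
      (fun x => max (f x) 0) (fun x => max (F x) 0) (by fun_prop) (fun x => le_max_right _ _)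
      (Lp_int f).pos_part hf2 (by fun_prop) (fun x => le_max_right _ _) ?_
    intro x hx
    have h1 := hpt x hx
    have h2 := hW1 x
    have h3 : 0 ≤ max (f x) 0 := le_max_right _ _
    have h4 : f x ≤ max (f x) 0 := le_max_left _ _
    have h5 : max (f x) 0 * W x ≤ 4 * (max (f x) 0 * Real.exp (dist x x₀ ^ p)) := by
      nlinarith
    apply max_le
    · by_cases hxR : x ∈ closedBall x₀ R
      · simp only [hF, indicator_of_mem hxR]
        nlinarith
      · simp only [hF, indicator_of_notMem hxR]
        positivity
    · positivity
  have T2 : ∀ r, m ≤ r → ∫ x in (closedBall x₀ r)ᶜ, max (-F x) 0 ∂μ ≤ 1 / 4 * α₂ r * I := by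
    refine tail_int μ x₀ m p I α₁ α₂ hI H.hm hp H.ha H.hb (fun s => (H.h2 s).le)
      (fun x => max (-f x) 0) (fun x => max (-F x) 0) (by fun_prop) (fun x => le_max_right _ _)
      (Lp_int f).neg_part hf3 (by fun_prop) (fun x => le_max_right _ _) ?_
    intro x hx
    have h1 := hpt x hx
    have h2 := hW1 x
    have h3 : 0 ≤ max (-f x) 0 := le_max_right _ _
    have h4 : -f x ≤ max (-f x) 0 := le_max_left _ _
    have h5 : max (-f x) 0 * W x ≤ 4 * (max (-f x) 0 * Real.exp (dist x x₀ ^ p)) := by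
      nlinarith
    apply max_le
    · by_cases hxR : x ∈ closedBall x₀ R
      · simp only [hF, indicator_of_mem hxR]
        nlinarith
      · simp only [hF, indicator_of_notMem hxR]
        simp only [neg_zero]
        positivity
    · positivity
  have hsub := closedBall_subset_closedBall (x := x₀) hR
  have J : 1 / 2 * I ≤ ∫ x, F x ∂μ := by
    rw [← integral_add_compl (hms m) hFi]
    have j1 : ∫ x in closedBall x₀ m, f x ∂μ ≤ ∫ x in closedBall x₀ m, F x ∂μ := by
      refine setIntegral_mono_on_ae (Lp_int f).integrableOn hFi.integrableOn (hms m) ?_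
      filter_upwards [hf1] with x hx hxm
      simp only [hF, indicator_of_mem (hsub hxm)]
      nlinarith [hx hxm, hW1 x]
    have j2 : -∫ x in (closedBall x₀ m)ᶜ, max (-F x) 0 ∂μ ≤
        ∫ x in (closedBall x₀ m)ᶜ, F x ∂μ := by
      rw [← integral_neg]
      refine integral_mono hFi.neg_part.neg.integrableOn hFi.integrableOn fun x => ?_
      have := le_max_left (-F x) 0
      simp only
      linarith
    have j3 : ∫ x in (closedBall x₀ m)ᶜ, f x ∂μ ≤ ∫ x in (closedBall x₀ m)ᶜ, max (f x) 0 ∂μ :=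
      integral_mono (Lp_int f).integrableOn (Lp_int f).pos_part.integrableOn
        fun x => le_max_left _ _
    have j4 := integral_add_compl (hms m) (Lp_int f)
    have j5 := hf2 m le_rfl
    have j6 := T2 m le_rfl
    have j7 := mul_le_mul_of_nonneg_right (H.hα m le_rfl) hI
    have j8 := mul_le_mul_of_nonneg_right (H.h3 m le_rfl) hI
    simp only [← hIdef] at j4 j5
    linarith
  have Jr : ∀ r, 1 / 4 * α₂ r * I ≤ α₂ r * ∫ x, F x ∂μ := by
    intro r
    have h2 := H.h2 r
    have := mul_le_mul_of_nonneg_left J h2.le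
    have := mul_nonneg h2.le hI
    linarith
  refine ⟨?_, fun r hr => (T1 r hr).trans (Jr r), fun r hr => (T2 r hr).trans (Jr r)⟩
  filter_upwards [hf1] with x hx hxm
  simp only [hF, indicator_of_mem (hsub hxm)]
  exact mul_nonneg (hx hxm) (by linarith [hW1 x])

lemma key2 (H : Good μ x₀ c ε p α₁ α₂ m) (hp : 0 < p) {u v : X → ℝ} {U V : ℝ}
    (hu : Bd x₀ m p u U) (hv : Bd x₀ m p v V) (φ ψ : Lp ℝ 2 μ) (a b : ℝ)
    (hφ : φ =ᵐ[μ] fun x => a * u x + b * v x)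
    (hψ : ψ =ᵐ[μ] fun x => a * (v x)⁻¹ + b * (u x)⁻¹)
    (hG : φ ∈ Gcone μ x₀ m m α₂ α₂) : ψ ∈ Gcone μ x₀ m m α₁ α₁ := by
  intro f hf
  have hU := hu.Upos
  have hV := hv.Upos
  have hi : Integrable (fun x => f x * ψ x) μ := (Lp.memLp f).integrable_mul (Lp.memLp ψ)
  have hms : ∀ r, MeasurableSet (closedBall x₀ r) := fun r => by measurability
  have hR : ∀ R, m ≤ R → 0 ≤ ∫ x in closedBall x₀ R, f x * ψ x ∂μ := by
    intro R hR
    obtain ⟨k1, k2⟩ := key H hp hu hv f hf R hR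
    have k3 := Gcone_apply hG k1 k2
    have e : ∫ x, (closedBall x₀ R).indicator (fun x => f x * (U / u x * (V / v x))) x * φ x ∂μ
        = (U * V) * ∫ x in closedBall x₀ R, f x * ψ x ∂μ := by
      rw [← integral_indicator (hms R), ← integral_const_mul]
      apply integral_congr_ae
      filter_upwards [hφ, hψ] with x h1 h2
      by_cases hx : x ∈ closedBall x₀ R
      · simp only [indicator_of_mem hx, h1, h2]
        have := hu.pos x
        have := hv.pos x
        field_simp
      · simp [indicator_of_notMem hx]
    rw [e] at k3
    exact nonneg_of_mul_nonneg_right k3 (mul_pos hU hV)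
  have hlim : Tendsto (fun n : ℕ => ∫ x in closedBall x₀ (n : ℝ), f x * ψ x ∂μ) atTop
      (𝓝 (∫ x in ⋃ n : ℕ, closedBall x₀ (n : ℝ), f x * ψ x ∂μ)) := by
    refine tendsto_setIntegral_of_monotone (fun n => hms n) ?_ hi.integrableOn
    intro i j hij
    exact closedBall_subset_closedBall (by exact_mod_cast hij)
  rw [iUnion_closedBall_nat, setIntegral_univ] at hlim
  refine ge_of_tendsto hlim ?_
  filter_upwards [eventually_ge_atTop ⌈m⌉₊] with n hn
  exact hR n (Nat.ceil_le.mp hn)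

/-- testing against the indicator of the ball. -/
lemma ball_test (g : Lp ℝ 2 μ) (hα : ∀ s, 0 < α₂ s) (hG : g ∈ Gcone μ x₀ m m α₂ α₂) :
    0 ≤ ∫ x in closedBall x₀ m, g x ∂μ := by
  have hms : MeasurableSet (closedBall x₀ m) := by measurability
  have h1 : MemLp ((closedBall x₀ m).indicator fun _ => (1 : ℝ)) 2 μ :=
    (memLp_const 1).indicator hms
  have hnn : 0 ≤ ∫ x, (closedBall x₀ m).indicator (fun _ => (1 : ℝ)) x ∂μ :=
    integral_nonneg fun x => indicator_nonneg (fun _ _ => zero_le_one) x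
  have h2 : PF μ x₀ m α₂ ((closedBall x₀ m).indicator fun _ => (1 : ℝ)) := by
    refine ⟨Eventually.of_forall fun x hx => by simp [hx], ?_, ?_⟩
    · intro r hr
      rw [setIntegral_congr_fun (g := fun _ => (0 : ℝ)) (by measurability)]
      · simpa using mul_nonneg (hα r).le hnn
      · intro x hx
        have : x ∉ closedBall x₀ m := fun h => hx (closedBall_subset_closedBall hr h)
        simp only [indicator_of_notMem this, max_self]
    · intro r hr
      rw [setIntegral_congr_fun (g := fun _ => (0 : ℝ)) (by measurability)]
      · simpa using mul_nonneg (hα r).le hnn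
      · intro x hx
        have : x ∉ closedBall x₀ m := fun h => hx (closedBall_subset_closedBall hr h)
        simp only [indicator_of_notMem this, neg_zero, max_self]
  have h3 := Gcone_apply hG h1 h2
  rw [← integral_indicator hms]
  refine h3.trans_eq (integral_congr_ae (Eventually.of_forall fun x => ?_))
  by_cases hx : x ∈ closedBall x₀ m <;> simp [hx]

lemma final (H : Good μ x₀ c ε p α₁ α₂ m) (hp : 0 < p) {u v : X → ℝ} {U V : ℝ}
    (hu : Bd x₀ m p u U) (hv : Bd x₀ m p v V)
    (h1 : MemLp u 2 μ) (h2 : MemLp v 2 μ) (h3 : MemLp (fun x => (u x)⁻¹) 2 μ)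
    (h4 : MemLp (fun x => (v x)⁻¹) 2 μ) :
    hilbertD (Gcone μ x₀ m m α₁ α₁) (h3.toLp _) (h4.toLp _) ≤
      hilbertD (Gcone μ x₀ m m α₂ α₂) (h1.toLp _) (h2.toLp _) := by
  have hμB : 0 < μ (closedBall x₀ m) := by
    have := H.real
    rw [measureReal_def] at this
    by_contra hcon
    have h0 : μ (closedBall x₀ m) = 0 := by simpa using hcon
    rw [h0] at this
    norm_num at this
  have ipos : ∀ {w : X → ℝ} {S : ℝ}, Bd x₀ m p w S → MemLp w 2 μ →
      0 < ∫ x in closedBall x₀ m, w x ∂μ := by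
    intro w S hw hw2
    rw [setIntegral_pos_iff_support_of_nonneg_ae
      (Eventually.of_forall fun x => (hw.pos x).le) (hw2.integrable (by norm_num)).integrableOn]
    have : Function.support w = univ := by
      ext x; simpa using (hw.pos x).ne'
    rw [this, univ_inter]
    exact hμB
  have iu := ipos hu h1
  have iv := ipos hv h2
  have hui : Integrable u μ := h1.integrable (by norm_num)
  have hvi : Integrable v μ := h2.integrable (by norm_num)
  set A := ∫ x in closedBall x₀ m, u x ∂μ with hA
  set B := ∫ x in closedBall x₀ m, v x ∂μ with hB
  have c1 := h1.coeFn_toLp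
  have c2 := h2.coeFn_toLp
  have c3 := h3.coeFn_toLp
  have c4 := h4.coeFn_toLp
  apply hilbert_le (K := A / B) (k := A / B) (hk := div_pos iu iv)
  · intro h0
    rw [Lp.eq_zero_iff_ae_eq_zero] at h0
    have : ∀ᵐ x ∂μ, False := by
      filter_upwards [h0, c4] with x hx1 hx2
      rw [hx2] at hx1
      exact (inv_pos.mpr (hv.pos x)).ne' hx1
    simp only [eventually_false_iff_eq_bot, ae_eq_bot] at this
    exact IsProbabilityMeasure.ne_zero μ this
  · intro a ha hG
    have e := key2 H hp hu hv _ (h4.toLp _ - a • h3.toLp _) 1 (-a) ?_ ?_ hG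
    · intro f hf
      have := e f hf
      have h := mul_nonneg (inv_pos.mpr ha).le this
      rw [← integral_const_mul] at h
      refine h.trans_eq (integral_congr_ae ?_)
      filter_upwards [Lp.coeFn_sub (h4.toLp _) (a • h3.toLp _), Lp.coeFn_smul a (h3.toLp _),
        Lp.coeFn_sub (a⁻¹ • h4.toLp _) (h3.toLp _), Lp.coeFn_smul a⁻¹ (h4.toLp _)]
        with x d1 d2 d3 d4
      simp only [d1, d3, Pi.sub_apply, d2, d4, Pi.smul_apply, smul_eq_mul]
      field_simp
    · filter_upwards [Lp.coeFn_sub (h1.toLp _) (a • h2.toLp _), Lp.coeFn_smul a (h2.toLp _),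
        c1, c2] with x d1 d2 d3 d4
      simp only [d1, Pi.sub_apply, d2, d3, d4, Pi.smul_apply, smul_eq_mul]
      ring
    · filter_upwards [Lp.coeFn_sub (h4.toLp _) (a • h3.toLp _), Lp.coeFn_smul a (h3.toLp _),
        c3, c4] with x d1 d2 d3 d4
      simp only [d1, Pi.sub_apply, d2, d3, d4, Pi.smul_apply, smul_eq_mul]
      ring
  · intro b hb hG
    have e := key2 H hp hu hv _ (b • h3.toLp _ - h4.toLp _) (-1) b ?_ ?_ hG
    · intro f hf
      have := e f hf
      have h := mul_nonneg (inv_pos.mpr hb).le this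
      rw [← integral_const_mul] at h
      refine h.trans_eq (integral_congr_ae ?_)
      filter_upwards [Lp.coeFn_sub (b • h3.toLp _) (h4.toLp _), Lp.coeFn_smul b (h3.toLp _),
        Lp.coeFn_sub (h3.toLp _) (b⁻¹ • h4.toLp _), Lp.coeFn_smul b⁻¹ (h4.toLp _)]
        with x d1 d2 d3 d4
      simp only [d1, d3, Pi.sub_apply, d2, d4, Pi.smul_apply, smul_eq_mul]
      field_simp
    · filter_upwards [Lp.coeFn_sub (b • h2.toLp _) (h1.toLp _), Lp.coeFn_smul b (h2.toLp _),
        c1, c2] with x d1 d2 d3 d4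
      simp only [d1, Pi.sub_apply, d2, d3, d4, Pi.smul_apply, smul_eq_mul]
      ring
    · filter_upwards [Lp.coeFn_sub (b • h3.toLp _) (h4.toLp _), Lp.coeFn_smul b (h3.toLp _),
        c3, c4] with x d1 d2 d3 d4
      simp only [d1, Pi.sub_apply, d2, d3, d4, Pi.smul_apply, smul_eq_mul]
      ring
  · intro a ha hG
    have h := ball_test _ H.h2 hG
    have e : ∫ x in closedBall x₀ m, (h1.toLp _ - a • h2.toLp _ : Lp ℝ 2 μ) x ∂μ = A - a * B := by
      rw [hA, hB, ← integral_const_mul,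
        ← integral_sub hui.integrableOn (hvi.const_mul a).integrableOn]
      apply integral_congr_ae
      apply ae_restrict_of_ae
      filter_upwards [Lp.coeFn_sub (h1.toLp _) (a • h2.toLp _), Lp.coeFn_smul a (h2.toLp _),
        c1, c2] with x d1 d2 d3 d4
      simp only [d1, Pi.sub_apply, d2, d3, d4, Pi.smul_apply, smul_eq_mul]
    rw [e] at h
    rw [le_div_iff₀ iv]; linarith
  · intro b hb hG
    have h := ball_test _ H.h2 hG
    have e : ∫ x in closedBall x₀ m, (b • h2.toLp _ - h1.toLp _ : Lp ℝ 2 μ) x ∂μ = b * B - A := by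
      rw [hA, hB, ← integral_const_mul,
        ← integral_sub (hvi.const_mul b).integrableOn hui.integrableOn]
      apply integral_congr_ae
      apply ae_restrict_of_ae
      filter_upwards [Lp.coeFn_sub (b • h2.toLp _) (h1.toLp _), Lp.coeFn_smul b (h2.toLp _),
        c1, c2] with x d1 d2 d3 d4
      simp only [d1, Pi.sub_apply, d2, d3, d4, Pi.smul_apply, smul_eq_mul]
    rw [e] at h
    rw [div_le_iff₀ iv]; linarith

end

theorem statement17 (μ ν : Measure X) [IsProbabilityMeasure μ] [IsProbabilityMeasure ν]
    (x₀ : X) (c : X → X → ℝ) (hcmeas : Measurable (Function.uncurry c))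
    (hcnn : ∀ x y, 0 ≤ c x y) (ε : ℝ) (hε : 0 < ε)
    (p δ : ℝ) (hp : 0 < p) (hδ : 0 < δ)
    (hcbdd : ∀ r : ℝ,
      BddAbove {v : ℝ | ∃ x ∈ closedBall x₀ r, ∃ y ∈ closedBall x₀ r, v = c x y})
    (hclim : Tendsto (fun r : ℝ =>
        sSup {v : ℝ | ∃ x ∈ closedBall x₀ r, ∃ y ∈ closedBall x₀ r, v = c x y} / r ^ p)
      atTop (𝓝 0))
    (htaillim : Tendsto (fun r : ℝ =>
        max (μ ((closedBall x₀ r)ᶜ)).toReal (ν ((closedBall x₀ r)ᶜ)).toReal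
          / Real.exp (-r ^ (p + δ))) atTop (𝓝 0))
    (p₁ p₂ : ℝ) (hpp₂ : p < p₂) (hp₂p₁ : p₂ < p₁) (hp₁ : p₁ < p + δ) :
    ∃ mlow : ℝ, 0 < mlow ∧ ∀ m : ℝ, mlow ≤ m →
      ∀ g ∈ Gcone μ x₀ m m (fun r => Real.exp (-r ^ p₁)) (fun r => Real.exp (-r ^ p₁)),
        (∀ᵐ x ∂μ, 0 ≤ g x) → 0 < ∫ x, g x ∂μ →
      ∀ g' ∈ Gcone μ x₀ m m (fun r => Real.exp (-r ^ p₁)) (fun r => Real.exp (-r ^ p₁)),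
        (∀ᵐ x ∂μ, 0 ≤ g' x) → 0 < ∫ x, g' x ∂μ →
      ∃ (h1 : MemLp (Lker (fun a b => Real.exp (-c b a / ε)) μ ⇑g) 2 μ)
        (h2 : MemLp (Lker (fun a b => Real.exp (-c b a / ε)) μ ⇑g') 2 μ)
        (h3 : MemLp (fun x => (Lker (fun a b => Real.exp (-c b a / ε)) μ (⇑g) x)⁻¹) 2 μ)
        (h4 : MemLp (fun x => (Lker (fun a b => Real.exp (-c b a / ε)) μ (⇑g') x)⁻¹) 2 μ),
        hilbertD (Gcone μ x₀ m m (fun r => Real.exp (-r ^ p₁)) (fun r => Real.exp (-r ^ p₁)))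
            (h3.toLp _) (h4.toLp _)
          ≤ hilbertD (Gcone μ x₀ m m (fun r => Real.exp (-r ^ p₂)) (fun r => Real.exp (-r ^ p₂)))
            (h1.toLp _) (h2.toLp _) := by
  obtain ⟨mlow, h0, hgood⟩ := exists_good μ ν x₀ c ε hε p δ hp hcbdd hclim htaillim p₁ p₂
    hpp₂ hp₂p₁ hp₁
  refine ⟨mlow, h0, fun m hm g hg hg0 hgp g' hg' hg0' hgp' => ?_⟩
  have H := hgood m hm
  have bu : Bd x₀ m p (Lker (fun a b => Real.exp (-c b a / ε)) μ g) (∫ x, g x ∂μ) :=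
    ⟨L_meas hcmeas g, L_pos H hcmeas hcnn hε hg hg0 hgp, L_le hcmeas hcnn hε g hg0,
      L_ge H hcmeas hcnn hε hg hg0⟩
  have bv : Bd x₀ m p (Lker (fun a b => Real.exp (-c b a / ε)) μ g') (∫ x, g' x ∂μ) :=
    ⟨L_meas hcmeas g', L_pos H hcmeas hcnn hε hg' hg0' hgp', L_le hcmeas hcnn hε g' hg0',
      L_ge H hcmeas hcnn hε hg' hg0'⟩
  exact ⟨bu.memLp, bv.memLp, bu.memLp_inv H hp, bv.memLp_inv H hp, final H hp bu bv _ _ _ _⟩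

end Paper
end
end

section
/- Let μ, ν be Borel probability measures on 𝒳, c : 𝒳×𝒳 → [0,∞) measurable, ε > 0, and K(x,y) := exp(−c(x,y)/ε). Assume there exist p > 0 and δ > 0 such that lim_{r→∞} ( sup_{x,y ∈ B_r} c(x,y) )/r^p = 0 and lim_{r→∞} max{μ(B_r^c), ν(B_r^c)}/exp(−r^{p+δ}) = 0. Set α(r) := exp(−r^{p+δ/2}). Then there exists m̲ > 0 such that for all m₁ = m₂ = m ≥ m̲ there exists κ ∈ (0,1) such that the Sinkhorn step map T(g) := S( L_{K,ν}( S( L_{K^⊤,μ}(g) ) ) ), where S(h) := 1/h pointwise, satisfies d_{𝓖^μ_{α,α}}(T(g), T(g̃)) ≤ κ·d_{𝓖^μ_{α,α}}(g, g̃) for all g, g̃ ∈ 𝓖^μ_{α,α} with g, g̃ ≥ 0 μ-a.s. and ∫ g dμ > 0, ∫ g̃ dμ > 0. -/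
open MeasureTheory Metric Set Filter
open scoped ENNReal NNReal Topology

noncomputable section

namespace Paper

variable {X : Type*} [MeasurableSpace X] [MetricSpace X] [PolishSpace X] [BorelSpace X]

set_option linter.unusedSectionVars false

/-- dual cone -/
def dualC {Y : Type*} [MeasurableSpace Y] (μ : Measure Y) (F : Set (Lp ℝ 2 μ)) : Set (Lp ℝ 2 μ) :=
  {g | ∀ f ∈ F, 0 ≤ ∫ x, f x * g x ∂μ}

/-- All quantitative facts used in the contraction argument. -/
structure Good_s18 {Y : Type*} [MeasurableSpace Y] (μ ν : Measure Y) (K : Y → Y → ℝ)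
    (F : Set (Lp ℝ 2 μ)) (B : Set Y) (Φ : Y → ℝ) (E τ : ℝ) : Prop where
  hB : MeasurableSet B
  K_meas : Measurable (Function.uncurry K)
  K_pos : ∀ x y, 0 < K x y
  K_le : ∀ x y, K x y ≤ 1
  Φ_meas : Measurable Φ
  Φ_ge : ∀ x, E ≤ Φ x
  Φ_B : ∀ x ∈ B, Φ x = E
  K_lowL : ∀ x, ∀ y ∈ B, 1 ≤ K x y * Φ x
  K_lowR : ∀ x ∈ B, ∀ y, 1 ≤ K x y * Φ y
  E_ge : 1000 ≤ E
  τ_pos : 0 < τ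
  τ_le : τ * E ^ 20 ≤ 1
  μB : 1 / 2 ≤ μ.real B
  νB : 1 / 2 ≤ ν.real B
  F_in : ∀ (f : Y → ℝ) (hf : MemLp f 2 μ), (∀ x ∈ B, 0 ≤ f x) → (∀ x, x ∉ B → |f x| ≤ 1) →
    2 * τ ≤ ∫ x in B, f x ∂μ → hf.toLp f ∈ F
  F_int : ∀ f ∈ F, IntegrableOn (fun x => |f x| * Φ x ^ 4) Bᶜ μ
  F_tail : ∀ f ∈ F, ∫ x in Bᶜ, |f x| * Φ x ^ 4 ∂μ ≤ τ * ∫ x, f x ∂μ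
  F_nn : ∀ f ∈ F, ∀ᵐ x ∂μ, x ∈ B → 0 ≤ f x
  ν_int : IntegrableOn (fun x => Φ x ^ 4) Bᶜ ν
  ν_tail : ∫ x in Bᶜ, Φ x ^ 4 ∂ν ≤ τ
  μ_int : MemLp Φ 2 μ

section abstract_part

variable {Y : Type*} [MeasurableSpace Y] {μ ν : Measure Y} [IsProbabilityMeasure μ]
  [IsProbabilityMeasure ν] {K : Y → Y → ℝ} {F : Set (Lp ℝ 2 μ)} {B : Set Y} {Φ : Y → ℝ} {E τ : ℝ}

lemma lp_int (f : Lp ℝ 2 μ) : Integrable f μ :=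
  (Lp.memLp f).integrable (by norm_num)

lemma lp_mul_int (f g : Lp ℝ 2 μ) : Integrable (fun x => f x * g x) μ :=
  MemLp.integrable_mul (Lp.memLp f) (Lp.memLp g)

lemma Good_s18.E_pos (H : Good_s18 μ ν K F B Φ E τ) : 0 < E := by linarith [H.E_ge]

lemma Good_s18.τ_small (H : Good_s18 μ ν K F B Φ E τ) : τ ≤ 1 / 1000 := by
  have h1 := H.E_ge
  have h2 := H.τ_le
  have h4 : (1000 : ℝ) ≤ E ^ 20 := h1.trans (le_self_pow₀ (by linarith) (by norm_num))
  have := mul_le_mul_of_nonneg_left h4 H.τ_pos.le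
  linarith

lemma Good_s18.τE (H : Good_s18 μ ν K F B Φ E τ) : τ * E ≤ 1 / 1000 := by
  have h1 := H.E_ge
  have h2 := H.τ_le
  have h4 : (1000 : ℝ) ≤ E ^ 19 := h1.trans (le_self_pow₀ (by linarith) (by norm_num))
  have := mul_le_mul_of_nonneg_left h4 (mul_pos H.τ_pos H.E_pos).le
  nlinarith

lemma Good_s18.τE2 (H : Good_s18 μ ν K F B Φ E τ) : τ * E ^ 2 ≤ 1 / 1000 := by
  have h1 := H.E_ge
  have h2 := H.τ_le
  have h4 : (1000 : ℝ) ≤ E ^ 18 := h1.trans (le_self_pow₀ (by linarith) (by norm_num))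
  have := mul_le_mul_of_nonneg_left h4 (mul_pos H.τ_pos (pow_pos H.E_pos 2)).le
  nlinarith

lemma G_in (H : Good_s18 μ ν K F B Φ E τ) (g : Lp ℝ 2 μ) (γ L : ℝ) (hL : 0 ≤ L)
    (h1 : ∀ᵐ x ∂μ, x ∈ B → γ ≤ g x) (h2 : ∀ᵐ x ∂μ, x ∉ B → |g x| ≤ L * Φ x ^ 4)
    (h3 : 2 * τ * L ≤ γ) : g ∈ dualC μ F := by
  intro f hf
  have hτ := H.τ_pos
  have hγ : 0 ≤ γ := by
    have : 0 ≤ 2 * τ * L := by positivity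
    linarith
  have hfi := lp_int f
  have hfg := lp_mul_int f g
  have e1 := integral_add_compl H.hB hfi
  have e2 := integral_add_compl H.hB hfg
  have hΦ1 : ∀ x, 1 ≤ Φ x ^ 4 := fun x => one_le_pow₀ (by linarith [H.Φ_ge x, H.E_ge])
  have b1 : ∫ x in B, γ * f x ∂μ ≤ ∫ x in B, f x * g x ∂μ := by
    refine setIntegral_mono_on_ae (hfi.const_mul γ).integrableOn hfg.integrableOn H.hB ?_
    filter_upwards [h1, H.F_nn f hf] with x hx hx' hxB
    nlinarith [hx hxB, hx' hxB]
  have b2 : ∫ x in Bᶜ, -(L * (|f x| * Φ x ^ 4)) ∂μ ≤ ∫ x in Bᶜ, f x * g x ∂μ := by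
    refine setIntegral_mono_on_ae ((H.F_int f hf).const_mul L).neg hfg.integrableOn H.hB.compl ?_
    filter_upwards [h2] with x hx hxB
    have h5 := hx hxB
    have h6 : |f x * g x| ≤ |f x| * (L * Φ x ^ 4) := by
      rw [abs_mul]; exact mul_le_mul_of_nonneg_left h5 (abs_nonneg _)
    have := neg_abs_le (f x * g x)
    linarith
  have b3 : ∫ x in Bᶜ, f x ∂μ ≤ ∫ x in Bᶜ, |f x| * Φ x ^ 4 ∂μ := by
    refine setIntegral_mono_on hfi.integrableOn (H.F_int f hf) H.hB.compl ?_
    intro x _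
    have := le_abs_self (f x)
    nlinarith [hΦ1 x, abs_nonneg (f x)]
  have b4 := H.F_tail f hf
  have b5 : 0 ≤ ∫ x in Bᶜ, |f x| * Φ x ^ 4 ∂μ := by
    refine integral_nonneg fun x => mul_nonneg (abs_nonneg _) (by linarith [hΦ1 x])
  rw [integral_const_mul] at b1
  rw [integral_neg, integral_const_mul] at b2
  have hf0 : 0 ≤ ∫ x, f x ∂μ := by
    by_contra hh
    push Not at hh
    nlinarith
  have hτs := H.τ_small
  have b6 : (1 / 2) * ∫ x, f x ∂μ ≤ ∫ x in B, f x ∂μ := by nlinarith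
  have b7 := mul_le_mul_of_nonneg_left b6 hγ
  have b8 := mul_le_mul_of_nonneg_left b4 hL
  have b9 := mul_le_mul_of_nonneg_right h3 hf0
  nlinarith

lemma G_test (H : Good_s18 μ ν K F B Φ E τ) (D : Lp ℝ 2 μ) (hD : D ∈ dualC μ F)
    (φ : Y → ℝ) (hφ : Measurable φ) (hφ1 : ∀ z, |φ z| ≤ 1) (k : ℝ)
    (hk : ∀ z ∈ B, 4 * τ ≤ φ z + k) :
    0 ≤ ∫ z, φ z * D z ∂μ + k * ∫ z in B, D z ∂μ := by
  have hτ := H.τ_pos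
  set ψ : Y → ℝ := fun z => φ z + B.indicator (fun _ => k) z with hψ
  have hψm : Measurable ψ := hφ.add (measurable_const.indicator H.hB)
  have hψL : MemLp ψ 2 μ := by
    refine MemLp.of_bound hψm.aestronglyMeasurable (1 + |k|) (Eventually.of_forall fun x => ?_)
    rw [Real.norm_eq_abs]
    refine (abs_add_le _ _).trans (add_le_add (hφ1 x) ?_)
    by_cases hx : x ∈ B <;> simp [hx]
  have hψB : ∀ z ∈ B, ψ z = φ z + k := fun z hz => by simp [hψ, hz]
  have hin := H.F_in ψ hψL (fun x hx => by rw [hψB x hx]; linarith [hk x hx])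
    (fun x hx => by simpa [hψ, hx] using hφ1 x) (by
      have := setIntegral_ge_of_const_le (c := 4 * τ) (f := ψ) H.hB (measure_ne_top μ B)
        (fun x hx => by rw [hψB x hx]; exact hk x hx) (hψL.integrable (by norm_num)).integrableOn
      rw [smul_eq_mul] at this
      nlinarith [H.μB])
  have h0 := hD _ hin
  have hφD : Integrable (fun z => φ z * D z) μ :=
    (lp_int D).bdd_mul (c := 1) hφ.aestronglyMeasurable (Eventually.of_forall hφ1)
  have e : ∫ x, (hψL.toLp ψ) x * D x ∂μ = ∫ z, (φ z * D z + B.indicator (fun z => k * D z) z) ∂μ := by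
    refine integral_congr_ae ?_
    filter_upwards [hψL.coeFn_toLp] with x hx
    rw [hx]
    by_cases hxB : x ∈ B <;> simp [hψ, hxB, add_mul]
  rw [e, integral_add hφD (((lp_int D).const_mul k).indicator H.hB), integral_indicator H.hB,
    integral_const_mul] at h0
  exact h0

/-- the four consequences of membership in the dual cone -/
lemma G_nonneg (H : Good_s18 μ ν K F B Φ E τ) (D : Lp ℝ 2 μ) (hD : D ∈ dualC μ F) :
    0 ≤ ∫ z in B, D z ∂μ := by
  have := G_test H D hD (fun _ => 0) measurable_const (by simp) (4 * τ) (by simp)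
  simp only [zero_mul, integral_zero, zero_add] at this
  have hτ := H.τ_pos
  exact nonneg_of_mul_nonneg_right this (by positivity)

lemma G_total (H : Good_s18 μ ν K F B Φ E τ) (D : Lp ℝ 2 μ) (hD : D ∈ dualC μ F) :
    ∫ z, D z ∂μ ≤ 2 * ∫ z in B, D z ∂μ := by
  have := G_test H D hD (fun _ => -1) measurable_const (by simp) 2
    (by intro z _; linarith [H.τ_small])
  simp only [neg_mul, one_mul, integral_neg] at this
  linarith

lemma Good_s18.K_measL (H : Good_s18 μ ν K F B Φ E τ) (y : Y) : Measurable (fun z => K z y) :=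
  H.K_meas.comp (measurable_id.prodMk measurable_const)

lemma Good_s18.K_measR (H : Good_s18 μ ν K F B Φ E τ) (x : Y) : Measurable (fun z => K x z) :=
  H.K_meas.comp (measurable_const.prodMk measurable_id)

lemma Good_s18.K_abs (H : Good_s18 μ ν K F B Φ E τ) (x y : Y) : |K x y| ≤ 1 := by
  rw [abs_of_pos (H.K_pos x y)]; exact H.K_le x y

lemma G_all (H : Good_s18 μ ν K F B Φ E τ) (D : Lp ℝ 2 μ) (hD : D ∈ dualC μ F) (y : Y) :
    -(4 * τ * ∫ z in B, D z ∂μ) ≤ ∫ z, K z y * D z ∂μ := by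
  have := G_test H D hD (fun z => K z y) (H.K_measL y) (fun z => H.K_abs z y) (4 * τ)
    (fun z _ => by linarith [H.K_pos z y])
  linarith

lemma G_B (H : Good_s18 μ ν K F B Φ E τ) (D : Lp ℝ 2 μ) (hD : D ∈ dualC μ F) (y : Y) (hy : y ∈ B) :
    1 / (2 * E) * ∫ z in B, D z ∂μ ≤ ∫ z, K z y * D z ∂μ := by
  have hE := H.E_pos
  have := G_test H D hD (fun z => K z y) (H.K_measL y) (fun z => H.K_abs z y) (-(1 / (2 * E)))
    (fun z hz => by
      have h1 := H.K_lowR z hz y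
      rw [H.Φ_B y hy] at h1
      have h2 : 1 / E ≤ K z y := by rwa [div_le_iff₀ hE]
      have h3 : 1 / (2 * E) = 1 / E / 2 := by field_simp
      have h4 : 8 * τ ≤ 1 / E := by rw [le_div_iff₀ hE]; linarith [H.τE]
      linarith)
  linarith

lemma K_int_s18 (H : Good_s18 μ ν K F B Φ E τ) (g : Lp ℝ 2 μ) (y : Y) :
    Integrable (fun z => K z y * g z) μ :=
  (lp_int g).bdd_mul (c := 1) (H.K_measL y).aestronglyMeasurable
    (Eventually.of_forall fun z => H.K_abs z y)

lemma h_meas (H : Good_s18 μ ν K F B Φ E τ) (g : Lp ℝ 2 μ) :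
    Measurable (fun y => ∫ z, K z y * g z ∂μ) := by
  refine (StronglyMeasurable.integral_prod_left (f := fun z y => K z y * g z) ?_).measurable
  exact (H.K_meas.mul ((Lp.stronglyMeasurable g).measurable.comp measurable_fst)).stronglyMeasurable

/-- bounds on the first kernel integral -/
lemma s_pos (H : Good_s18 μ ν K F B Φ E τ) (g : Lp ℝ 2 μ) (hg : g ∈ dualC μ F)
    (hi : 0 < ∫ x, g x ∂μ) : 0 < ∫ z in B, g z ∂μ := by
  have := G_total H g hg
  linarith

lemma h_upper (H : Good_s18 μ ν K F B Φ E τ) (g : Lp ℝ 2 μ) (hg : g ∈ dualC μ F)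
    (hn : ∀ᵐ x ∂μ, 0 ≤ g x) (y : Y) : ∫ z, K z y * g z ∂μ ≤ 2 * ∫ z in B, g z ∂μ := by
  refine le_trans ?_ (G_total H g hg)
  refine integral_mono_ae (K_int_s18 H g y) (lp_int g) ?_
  filter_upwards [hn] with x hx
  have := H.K_le x y
  show K x y * g x ≤ g x
  nlinarith

lemma h_lower (H : Good_s18 μ ν K F B Φ E τ) (g : Lp ℝ 2 μ)
    (hn : ∀ᵐ x ∂μ, 0 ≤ g x) (y : Y) : (∫ z in B, g z ∂μ) / Φ y ≤ ∫ z, K z y * g z ∂μ := by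
  have hΦ : 0 < Φ y := by linarith [H.Φ_ge y, H.E_pos]
  have h1 : ∫ z in B, (Φ y)⁻¹ * g z ∂μ ≤ ∫ z in B, K z y * g z ∂μ := by
    refine setIntegral_mono_on_ae ((lp_int g).const_mul _).integrableOn (K_int_s18 H g y).integrableOn
      H.hB ?_
    filter_upwards [hn] with x hx hxB
    refine mul_le_mul_of_nonneg_right ?_ hx
    rw [inv_le_iff_one_le_mul₀ hΦ]
    exact H.K_lowR x hxB y
  have h2 : ∫ z in B, K z y * g z ∂μ ≤ ∫ z, K z y * g z ∂μ := by
    refine setIntegral_le_integral (K_int_s18 H g y) ?_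
    filter_upwards [hn] with x hx
    exact mul_nonneg (H.K_pos x y).le hx
  rw [integral_const_mul] at h1
  rw [div_eq_inv_mul]
  exact h1.trans h2

lemma Good_s18.Φ_pos (H : Good_s18 μ ν K F B Φ E τ) (x : Y) : 0 < Φ x := by
  linarith [H.Φ_ge x, H.E_pos]

lemma Good_s18.Φ_one (H : Good_s18 μ ν K F B Φ E τ) (x : Y) : 1 ≤ Φ x := by
  linarith [H.Φ_ge x, H.E_ge]

lemma Good_s18.pow_int (H : Good_s18 μ ν K F B Φ E τ) (j : ℕ) (hj : j ≤ 4) :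
    Integrable (fun x => Φ x ^ j) ν ∧ ∫ x, Φ x ^ j ∂ν ≤ E ^ j + τ ∧
      ∫ x in Bᶜ, Φ x ^ j ∂ν ≤ τ := by
  have hc : IntegrableOn (fun x => Φ x ^ j) Bᶜ ν := by
    refine Integrable.mono' H.ν_int (H.Φ_meas.pow_const j).aestronglyMeasurable
      (Eventually.of_forall fun x => ?_)
    rw [Real.norm_eq_abs, abs_of_pos (pow_pos (H.Φ_pos x) j)]
    exact pow_le_pow_right₀ (H.Φ_one x) hj
  have hb : IntegrableOn (fun x => Φ x ^ j) B ν := by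
    refine (integrableOn_const (C := E ^ j) (measure_ne_top ν B)).congr_fun ?_ H.hB
    intro x hx
    simp only [H.Φ_B x hx]
  have hi : Integrable (fun x => Φ x ^ j) ν := by
    rw [← integrableOn_univ, ← union_compl_self B]
    exact hb.union hc
  have h3 : ∫ x in Bᶜ, Φ x ^ j ∂ν ≤ τ := by
    refine le_trans ?_ H.ν_tail
    refine setIntegral_mono_on hc H.ν_int H.hB.compl fun x _ => ?_
    exact pow_le_pow_right₀ (H.Φ_one x) hj
  refine ⟨hi, ?_, h3⟩
  rw [← integral_add_compl H.hB hi]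
  refine add_le_add ?_ h3
  have : ∫ x in B, Φ x ^ j ∂ν = ∫ x in B, E ^ j ∂ν :=
    setIntegral_congr_fun H.hB fun x hx => by simp only [H.Φ_B x hx]
  rw [this, setIntegral_const, smul_eq_mul]
  have h1 : ν.real B ≤ 1 := measureReal_le_one
  have := pow_pos H.E_pos j
  nlinarith

/-- Bounds for a first-step function. -/
structure HB (Φ : Y → ℝ) (h : Y → ℝ) (s : ℝ) : Prop where
  meas : Measurable h
  spos : 0 < s
  low : ∀ y, s / Φ y ≤ h y
  up : ∀ y, h y ≤ 2 * s

lemma HB.pos (H : Good_s18 μ ν K F B Φ E τ) {h : Y → ℝ} {s : ℝ} (hh : HB Φ h s) (y : Y) : 0 < h y :=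
  lt_of_lt_of_le (div_pos hh.spos (H.Φ_pos y)) (hh.low y)

lemma HB.inv_le (H : Good_s18 μ ν K F B Φ E τ) {h : Y → ℝ} {s : ℝ} (hh : HB Φ h s) (y : Y) :
    (h y)⁻¹ ≤ Φ y / s := by
  have h1 := inv_anti₀ (div_pos hh.spos (H.Φ_pos y)) (hh.low y)
  rwa [inv_div] at h1

lemma HB.le_inv (H : Good_s18 μ ν K F B Φ E τ) {h : Y → ℝ} {s : ℝ} (hh : HB Φ h s) (y : Y) :
    (2 * s)⁻¹ ≤ (h y)⁻¹ :=
  inv_anti₀ (hh.pos H y) (hh.up y)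

lemma θ_int (H : Good_s18 μ ν K F B Φ E τ) {h : Y → ℝ} {s : ℝ} (hh : HB Φ h s) (x : Y) :
    Integrable (fun y => K x y * (h y)⁻¹) ν := by
  have h1 := (H.pow_int 1 (by norm_num)).1
  simp only [pow_one] at h1
  refine Integrable.mono' (h1.div_const s)
    ((H.K_measR x).mul hh.meas.inv).aestronglyMeasurable (Eventually.of_forall fun y => ?_)
  have h2 := hh.inv_le H y
  have h3 : 0 < (h y)⁻¹ := inv_pos.2 (hh.pos H y)
  rw [Real.norm_eq_abs, abs_of_pos (mul_pos (H.K_pos x y) h3)]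
  have := H.K_le x y
  nlinarith

lemma θ_upper (H : Good_s18 μ ν K F B Φ E τ) {h : Y → ℝ} {s : ℝ} (hh : HB Φ h s) (x : Y) :
    ∫ y, K x y * (h y)⁻¹ ∂ν ≤ 2 * E / s := by
  obtain ⟨h1, h2, -⟩ := H.pow_int 1 (by norm_num)
  simp only [pow_one] at h1 h2
  have h3 : ∫ y, K x y * (h y)⁻¹ ∂ν ≤ ∫ y, Φ y / s ∂ν := by
    refine integral_mono (θ_int H hh x) (h1.div_const s) fun y => ?_
    have h2 := hh.inv_le H y
    have h3 : 0 < (h y)⁻¹ := inv_pos.2 (hh.pos H y)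
    have := H.K_le x y
    show K x y * (h y)⁻¹ ≤ Φ y / s
    nlinarith
  refine h3.trans ?_
  rw [integral_div]
  refine div_le_div_of_nonneg_right ?_ hh.spos.le
  linarith [H.E_ge, H.τ_small]

lemma θ_lower (H : Good_s18 μ ν K F B Φ E τ) {h : Y → ℝ} {s : ℝ} (hh : HB Φ h s) (x : Y) :
    1 / (4 * s * Φ x) ≤ ∫ y, K x y * (h y)⁻¹ ∂ν := by
  have hs := hh.spos
  have hΦ := H.Φ_pos x
  have h2 : ∫ y in B, K x y * (h y)⁻¹ ∂ν ≤ ∫ y, K x y * (h y)⁻¹ ∂ν := by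
    refine setIntegral_le_integral (θ_int H hh x) (Eventually.of_forall fun y => ?_)
    exact mul_nonneg (H.K_pos x y).le (inv_pos.2 (hh.pos H y)).le
  refine le_trans ?_ h2
  have := setIntegral_ge_of_const_le (c := (Φ x)⁻¹ * (2 * s)⁻¹) (f := fun y => K x y * (h y)⁻¹)
    H.hB (measure_ne_top ν B) (fun y hy => by
      refine mul_le_mul ?_ (hh.le_inv H y) (by positivity) (H.K_pos x y).le
      rw [inv_le_iff_one_le_mul₀ hΦ]
      exact H.K_lowL x y hy) (θ_int H hh x).integrableOn
  refine le_trans ?_ this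
  rw [smul_eq_mul]
  have e : 1 / (4 * s * Φ x) = 1 / 2 * ((Φ x)⁻¹ * (2 * s)⁻¹) := by field_simp; norm_num
  rw [e]
  exact mul_le_mul_of_nonneg_right H.νB (by positivity)

lemma T_lower (H : Good_s18 μ ν K F B Φ E τ) {h : Y → ℝ} {s : ℝ} (hh : HB Φ h s) (x : Y) :
    s / (2 * E) ≤ (∫ y, K x y * (h y)⁻¹ ∂ν)⁻¹ := by
  have hs := hh.spos
  have hΦ := H.Φ_pos x
  have h1 := θ_upper H hh x
  have h0 : 0 < ∫ y, K x y * (h y)⁻¹ ∂ν :=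
    lt_of_lt_of_le (by positivity) (θ_lower H hh x)
  have := inv_anti₀ h0 h1
  rwa [inv_div] at this

lemma T_upper (H : Good_s18 μ ν K F B Φ E τ) {h : Y → ℝ} {s : ℝ} (hh : HB Φ h s) (x : Y) :
    (∫ y, K x y * (h y)⁻¹ ∂ν)⁻¹ ≤ 4 * s * Φ x := by
  have hs := hh.spos
  have hΦ := H.Φ_pos x
  have := inv_anti₀ (by positivity) (θ_lower H hh x)
  rwa [inv_div, div_one] at this

lemma T_pos (H : Good_s18 μ ν K F B Φ E τ) {h : Y → ℝ} {s : ℝ} (hh : HB Φ h s) (x : Y) :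
    0 < (∫ y, K x y * (h y)⁻¹ ∂ν)⁻¹ :=
  lt_of_lt_of_le (div_pos hh.spos (by linarith [H.E_pos])) (T_lower H hh x)

lemma T_mem (H : Good_s18 μ ν K F B Φ E τ) {h : Y → ℝ} {s : ℝ} (hh : HB Φ h s) :
    MemLp (fun x => (∫ y, K x y * (h y)⁻¹ ∂ν)⁻¹) 2 μ := by
  refine MemLp.mono' (H.μ_int.const_mul (4 * s)) ?_ (Eventually.of_forall fun x => ?_)
  · refine Measurable.aestronglyMeasurable (Measurable.inv ?_)
    refine (StronglyMeasurable.integral_prod_right (f := fun x y => K x y * (h y)⁻¹) ?_).measurable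
    exact (H.K_meas.mul (hh.meas.inv.comp measurable_snd)).stronglyMeasurable
  · rw [Real.norm_eq_abs, abs_of_pos (T_pos H hh x)]
    exact T_upper H hh x

lemma θ_sub (H : Good_s18 μ ν K F B Φ E τ) {h h' : Y → ℝ} {s s' : ℝ} (hh : HB Φ h s)
    (hh' : HB Φ h' s') (A : ℝ) (x : Y) :
    Integrable (fun y => K x y * ((h y - A * h' y) / (h y * h' y))) ν ∧
    ∫ y, K x y * (h' y)⁻¹ ∂ν - A * ∫ y, K x y * (h y)⁻¹ ∂ν =
      ∫ y, K x y * ((h y - A * h' y) / (h y * h' y)) ∂ν := by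
  have e : (fun y => K x y * ((h y - A * h' y) / (h y * h' y))) =
      fun y => K x y * (h' y)⁻¹ - A * (K x y * (h y)⁻¹) := by
    funext y
    have h1 := hh.pos H y
    have h2 := hh'.pos H y
    field_simp
  rw [e]
  refine ⟨(θ_int H hh' x).sub ((θ_int H hh x).const_mul A), ?_⟩
  rw [integral_sub (θ_int H hh' x) ((θ_int H hh x).const_mul A), integral_const_mul]

lemma θ_abs (H : Good_s18 μ ν K F B Φ E τ) {h h' : Y → ℝ} {s s' : ℝ} (hh : HB Φ h s)
    (hh' : HB Φ h' s') (A C : ℝ) (hC : ∀ y, |h y - A * h' y| ≤ C) (x : Y) :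
    |∫ y, K x y * (h' y)⁻¹ ∂ν - A * ∫ y, K x y * (h y)⁻¹ ∂ν| ≤ 2 * E ^ 2 * C / (s * s') := by
  obtain ⟨h1, h2, -⟩ := H.pow_int 2 (by norm_num)
  obtain ⟨i1, e1⟩ := θ_sub H hh hh' A x
  have hs := hh.spos
  have hs' := hh'.spos
  have hC0 : 0 ≤ C := (abs_nonneg _).trans (hC x)
  rw [e1]
  have h3 : |∫ y, K x y * ((h y - A * h' y) / (h y * h' y)) ∂ν| ≤ ∫ y, Φ y ^ 2 * (C / (s * s')) ∂ν := by
    rw [← Real.norm_eq_abs]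
    refine norm_integral_le_of_norm_le (h1.mul_const _) (Eventually.of_forall fun y => ?_)
    have p1 := hh.pos H y
    have p2 := hh'.pos H y
    have hΦ := H.Φ_pos y
    rw [Real.norm_eq_abs, abs_mul, div_eq_mul_inv, mul_inv, abs_mul, abs_mul,
      abs_of_pos (inv_pos.2 p1), abs_of_pos (inv_pos.2 p2)]
    have a1 := mul_le_mul (hh.inv_le H y) (hh'.inv_le H y) (inv_pos.2 p2).le (by positivity)
    have a2 := mul_le_mul (hC y) a1 (mul_pos (inv_pos.2 p1) (inv_pos.2 p2)).le hC0
    have a3 := mul_le_mul (H.K_abs x y) a2 (by positivity) zero_le_one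
    refine a3.trans (le_of_eq ?_)
    field_simp
  refine h3.trans ?_
  rw [integral_mul_const]
  have h4 : ∫ y, Φ y ^ 2 ∂ν ≤ 2 * E ^ 2 := by
    nlinarith [H.E_ge, H.τ_small]
  have h5 := mul_le_mul_of_nonneg_right h4 (by positivity : 0 ≤ C / (s * s'))
  refine h5.trans (le_of_eq (by ring))

lemma θ_B (H : Good_s18 μ ν K F B Φ E τ) {h h' : Y → ℝ} {s s' : ℝ} (hh : HB Φ h s)
    (hh' : HB Φ h' s') (A u : ℝ) (hu : 0 ≤ u) (h1 : ∀ y ∈ B, u / (4 * E) ≤ h y - A * h' y)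
    (h2 : ∀ y, -u ≤ h y - A * h' y) (x : Y) (hx : x ∈ B) :
    A * ∫ y, K x y * (h y)⁻¹ ∂ν ≤ ∫ y, K x y * (h' y)⁻¹ ∂ν := by
  obtain ⟨q1, -, q2⟩ := H.pow_int 2 (by norm_num)
  obtain ⟨i1, e1⟩ := θ_sub H hh hh' A x
  have hs := hh.spos
  have hs' := hh'.spos
  have hE := H.E_pos
  have hτ := H.τ_pos
  rw [← sub_nonneg, e1, ← integral_add_compl H.hB i1]
  have b1 := setIntegral_ge_of_const_le (c := E⁻¹ * (u / (4 * E) * ((2 * s)⁻¹ * (2 * s')⁻¹)))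
    (f := fun y => K x y * ((h y - A * h' y) / (h y * h' y)))
    H.hB (measure_ne_top ν B) (fun y hy => by
      have p1 := hh.pos H y
      have p2 := hh'.pos H y
      have hd : 0 ≤ h y - A * h' y := le_trans (by positivity) (h1 y hy)
      refine mul_le_mul ?_ ?_ (by positivity) (H.K_pos x y).le
      · rw [inv_le_iff_one_le_mul₀ hE, ← H.Φ_B x hx]
        exact H.K_lowL x y hy
      · rw [div_eq_mul_inv (h y - A * h' y), mul_inv (h y)]
        refine mul_le_mul (h1 y hy) ?_ (by positivity) hd
        exact mul_le_mul (hh.le_inv H y) (hh'.le_inv H y) (by positivity) (inv_pos.2 p1).le)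
    i1.integrableOn
  have b2 : ∫ y in Bᶜ, -(Φ y ^ 2 * (u / (s * s'))) ∂ν ≤
      ∫ y in Bᶜ, K x y * ((h y - A * h' y) / (h y * h' y)) ∂ν := by
    refine setIntegral_mono_on (q1.mul_const _).neg.integrableOn i1.integrableOn H.hB.compl
      fun y _ => ?_
    have p1 := hh.pos H y
    have p2 := hh'.pos H y
    have hΦ := H.Φ_pos y
    have a1 := mul_le_mul (hh.inv_le H y) (hh'.inv_le H y) (inv_pos.2 p2).le (by positivity)
    have a0 : 0 < (h y)⁻¹ * (h' y)⁻¹ := mul_pos (inv_pos.2 p1) (inv_pos.2 p2)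
    rw [div_eq_mul_inv (h y - A * h' y), mul_inv (h y)]
    have a2 := mul_le_mul_of_nonneg_right (h2 y) a0.le
    have a3 := mul_le_mul_of_nonneg_left a1 hu
    have a4 := mul_le_mul_of_nonneg_left a2 (H.K_pos x y).le
    have a5 := mul_le_mul (H.K_le x y) a3 (by positivity) zero_le_one
    have a6 : 1 * (u * (Φ y / s * (Φ y / s'))) = Φ y ^ 2 * (u / (s * s')) := by field_simp
    rw [a6] at a5
    linarith
  rw [integral_neg, integral_mul_const] at b2
  rw [smul_eq_mul] at b1
  have c1 : (1 / 2) * (E⁻¹ * (u / (4 * E) * ((2 * s)⁻¹ * (2 * s')⁻¹))) ≤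
      ν.real B * (E⁻¹ * (u / (4 * E) * ((2 * s)⁻¹ * (2 * s')⁻¹))) :=
    mul_le_mul_of_nonneg_right H.νB (by positivity)
  have c2 := mul_le_mul_of_nonneg_right q2 (by positivity : 0 ≤ u / (s * s'))
  have c3 : (1 / 2) * (E⁻¹ * (u / (4 * E) * ((2 * s)⁻¹ * (2 * s')⁻¹))) =
      (1 / (32 * E ^ 2)) * (u / (s * s')) := by field_simp; ring
  have c4 : τ ≤ 1 / (32 * E ^ 2) := by
    rw [le_div_iff₀ (by positivity)]
    linarith [H.τE2]
  have c5 := mul_le_mul_of_nonneg_right c4 (by positivity : 0 ≤ u / (s * s'))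
  linarith

lemma Good_s18.τE3 (H : Good_s18 μ ν K F B Φ E τ) : τ * E ^ 3 ≤ 1 / 1000 := by
  have h1 := H.E_ge
  have h2 := H.τ_le
  have h4 : (1000 : ℝ) ≤ E ^ 17 := h1.trans (le_self_pow₀ (by linarith) (by norm_num))
  have := mul_le_mul_of_nonneg_left h4 (mul_pos H.τ_pos (pow_pos H.E_pos 3)).le
  nlinarith

lemma coe_sub_smul {T T' : Y → ℝ} (hm : MemLp T 2 μ) (hm' : MemLp T' 2 μ) (A : ℝ) :
    ((hm.toLp T - A • hm'.toLp T' : Lp ℝ 2 μ) : Y → ℝ) =ᵐ[μ] fun x => T x - A * T' x := by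
  filter_upwards [Lp.coeFn_sub (hm.toLp T) (A • hm'.toLp T'), Lp.coeFn_smul A (hm'.toLp T'),
    hm.coeFn_toLp, hm'.coeFn_toLp] with x h1 h2 h3 h4
  rw [h1, Pi.sub_apply, h2, Pi.smul_apply, h3, h4, smul_eq_mul]

lemma step_low (H : Good_s18 μ ν K F B Φ E τ) {h h' : Y → ℝ} {s s' : ℝ} (hh : HB Φ h s)
    (hh' : HB Φ h' s') (a b : ℝ) (hu : 0 ≤ s - a * s') (hv : 0 ≤ b * s' - s)
    (h1 : ∀ y ∈ B, 1 / (2 * E) * (s - a * s') ≤ h y - a * h' y)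
    (h2 : ∀ y, -(4 * τ * (s - a * s')) ≤ h y - a * h' y)
    (h3 : ∀ y, -(4 * τ * (b * s' - s)) ≤ b * h' y - h y)
    (hm : MemLp (fun x => (∫ y, K x y * (h y)⁻¹ ∂ν)⁻¹) 2 μ)
    (hm' : MemLp (fun x => (∫ y, K x y * (h' y)⁻¹ ∂ν)⁻¹) 2 μ) :
    hm.toLp _ - (a + (s - a * s') / (8 * E * s') - 400 * τ * E ^ 3 * (b - a)) • hm'.toLp _
      ∈ dualC μ F := by
  have hs := hh.spos
  have hs' := hh'.spos
  have hE := H.E_pos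
  have hτ := H.τ_pos
  have hτs := H.τ_small
  set u := s - a * s' with hu_def
  set v := b * s' - s with hv_def
  have huv : (b - a) * s' = u + v := by rw [hu_def, hv_def]; ring
  have hba : 0 ≤ b - a := by
    have : 0 ≤ (b - a) * s' := by linarith
    exact nonneg_of_mul_nonneg_left this hs'
  set A := a + u / (8 * E * s') with hA
  have hus : u / (8 * E * s') * s' = u / (8 * E) := by field_simp
  have hw0 : 0 ≤ u / (8 * E * s') := by positivity
  have e8 : u / (8 * E) = u / (4 * E) / 2 := by field_simp; ring
  have e4 : 1 / (2 * E) * u = 2 * (u / (4 * E)) := by field_simp; ring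
  have hu4 : u / (4 * E) ≤ u / 2 := by
    apply div_le_div_of_nonneg_left hu <;> linarith [H.E_ge]
  have hAB : ∀ x ∈ B, A * ∫ y, K x y * (h y)⁻¹ ∂ν ≤ ∫ y, K x y * (h' y)⁻¹ ∂ν := by
    refine θ_B H hh hh' A u hu (fun y hy => ?_) (fun y => ?_)
    · have k1 := h1 y hy
      have k2 := mul_le_mul_of_nonneg_left (hh'.up y) hw0
      have : h y - A * h' y = h y - a * h' y - u / (8 * E * s') * h' y := by rw [hA]; ring
      rw [this]
      nlinarith
    · have k1 := h2 y
      have k2 := mul_le_mul_of_nonneg_left (hh'.up y) hw0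
      have : h y - A * h' y = h y - a * h' y - u / (8 * E * s') * h' y := by rw [hA]; ring
      rw [this]
      nlinarith
  have habs := θ_abs H hh hh' a (3 * ((b - a) * s')) (fun y => by
    have k1 := h2 y
    have k2 := h3 y
    have k3 := mul_le_mul_of_nonneg_left (hh'.up y) hba
    have k4 : τ * u ≤ u / 1000 := by nlinarith
    have k5 : τ * v ≤ v / 1000 := by nlinarith
    rw [abs_le]
    constructor <;> nlinarith)
  have hwle : u / (8 * E * s') ≤ (b - a) := by
    rw [div_le_iff₀ (by positivity)]
    have : (b - a) * (8 * E * s') = ((b - a) * s') * (8 * E) := by ring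
    rw [this, huv]
    nlinarith [H.E_ge]
  have h400 : 400 * τ * E ^ 3 * (b - a) ≤ b - a := by
    have := H.τE3
    nlinarith
  have h400' : 0 ≤ 400 * τ * E ^ 3 * (b - a) := by positivity
  refine G_in H _ (200 * τ * E ^ 2 * (b - a) * s') (100 * E ^ 2 * (b - a) * s') (by positivity)
    ?_ ?_ (le_of_eq (by ring))
  · filter_upwards [coe_sub_smul hm hm' (A - 400 * τ * E ^ 3 * (b - a))] with x hx hxB
    rw [hx]
    have q := hAB x hxB
    have t0 := T_pos H hh x
    have t0' := T_pos H hh' x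
    have tl := T_lower H hh' x
    set θ := ∫ y, K x y * (h y)⁻¹ ∂ν
    set θ' := ∫ y, K x y * (h' y)⁻¹ ∂ν
    have p : 0 < θ := inv_pos.1 t0
    have p' : 0 < θ' := inv_pos.1 t0'
    have r : A * θ'⁻¹ ≤ θ⁻¹ := by
      rw [← div_eq_mul_inv, ← one_div, div_le_div_iff₀ p' p]; linarith
    have r2 := mul_le_mul_of_nonneg_left tl h400'
    have r3 : 400 * τ * E ^ 3 * (b - a) * (s' / (2 * E)) = 200 * τ * E ^ 2 * (b - a) * s' := by
      field_simp; ring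
    linarith
  · filter_upwards [coe_sub_smul hm hm' (A - 400 * τ * E ^ 3 * (b - a))] with x hx hxB
    rw [hx]
    have q := habs x
    have t0 := T_pos H hh x
    have t0' := T_pos H hh' x
    have tu := T_upper H hh x
    have tu' := T_upper H hh' x
    have hΦ := H.Φ_pos x
    have hΦ1 := H.Φ_one x
    set θ := ∫ y, K x y * (h y)⁻¹ ∂ν
    set θ' := ∫ y, K x y * (h' y)⁻¹ ∂ν
    have p : 0 < θ := inv_pos.1 t0
    have p' : 0 < θ' := inv_pos.1 t0'
    have e : θ⁻¹ - (A - 400 * τ * E ^ 3 * (b - a)) * θ'⁻¹ =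
        (θ' - a * θ) * (θ⁻¹ * θ'⁻¹) + (400 * τ * E ^ 3 * (b - a) - u / (8 * E * s')) * θ'⁻¹ := by
      rw [hA]; field_simp; ring
    rw [e]
    have z1 : |(θ' - a * θ) * (θ⁻¹ * θ'⁻¹)| ≤ 96 * E ^ 2 * (b - a) * s' * Φ x ^ 2 := by
      rw [abs_mul, abs_of_pos (mul_pos t0 t0')]
      have y1 := mul_le_mul tu tu' t0'.le (by positivity)
      have y2 := mul_le_mul q y1 (mul_pos t0 t0').le (by positivity)
      refine y2.trans (le_of_eq ?_)
      field_simp; ring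
    have z2 : |(400 * τ * E ^ 3 * (b - a) - u / (8 * E * s')) * θ'⁻¹| ≤
        (b - a) * (4 * s' * Φ x) := by
      rw [abs_mul, abs_of_pos t0']
      refine mul_le_mul ?_ tu' t0'.le hba
      rw [abs_le]; constructor <;> linarith
    refine (abs_add_le _ _).trans ((add_le_add z1 z2).trans ?_)
    have w1 : Φ x ^ 2 ≤ Φ x ^ 4 := pow_le_pow_right₀ hΦ1 (by norm_num)
    have w2 : Φ x ≤ Φ x ^ 4 := le_self_pow₀ hΦ1 (by norm_num)
    have w3 : 1 ≤ E ^ 2 := one_le_pow₀ (by linarith [H.E_ge])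
    have w4 : 0 ≤ (b - a) * s' := by positivity
    have w5 := mul_le_mul_of_nonneg_left w1 (by positivity : 0 ≤ 96 * E ^ 2 * (b - a) * s')
    have w6 := mul_le_mul w3 w2 hΦ.le (by positivity)
    have w7 := mul_le_mul_of_nonneg_left w6 (by positivity : 0 ≤ 4 * ((b - a) * s'))
    linarith

lemma step_diam (H : Good_s18 μ ν K F B Φ E τ) {h h' : Y → ℝ} {s s' : ℝ} (hh : HB Φ h s)
    (hh' : HB Φ h' s')
    (hm : MemLp (fun x => (∫ y, K x y * (h y)⁻¹ ∂ν)⁻¹) 2 μ)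
    (hm' : MemLp (fun x => (∫ y, K x y * (h' y)⁻¹ ∂ν)⁻¹) 2 μ) :
    hm.toLp _ - (s / (16 * E ^ 2 * s')) • hm'.toLp _ ∈ dualC μ F := by
  have hs := hh.spos
  have hs' := hh'.spos
  have hE := H.E_pos
  have hτ := H.τ_pos
  have hc : 0 < s / (16 * E ^ 2 * s') := by positivity
  refine G_in H _ (s / (4 * E)) (8 * s) (by positivity) ?_ ?_ ?_
  · filter_upwards [coe_sub_smul hm hm' (s / (16 * E ^ 2 * s'))] with x hx hxB
    rw [hx]
    have tl := T_lower H hh x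
    have tu := T_upper H hh' x
    rw [H.Φ_B x hxB] at tu
    have := mul_le_mul_of_nonneg_left tu hc.le
    have e1 : s / (16 * E ^ 2 * s') * (4 * s' * E) = s / (4 * E) := by field_simp; norm_num
    have e2 : s / (2 * E) = 2 * (s / (4 * E)) := by field_simp; norm_num
    linarith
  · filter_upwards [coe_sub_smul hm hm' (s / (16 * E ^ 2 * s'))] with x hx hxB
    rw [hx]
    have t0 := T_pos H hh x
    have t0' := T_pos H hh' x
    have tu := T_upper H hh x
    have tu' := T_upper H hh' x
    have hΦ := H.Φ_pos x
    have w2 : Φ x ≤ Φ x ^ 4 := le_self_pow₀ (H.Φ_one x) (by norm_num)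
    have k1 := mul_le_mul_of_nonneg_left tu' hc.le
    have k2 : s / (16 * E ^ 2 * s') * (4 * s' * Φ x) = s * Φ x * (1 / (4 * E ^ 2)) := by
      field_simp; norm_num
    have k3 : 1 / (4 * E ^ 2) ≤ 1 := by
      rw [div_le_one (by positivity)]; nlinarith [H.E_ge]
    have k4 := mul_le_mul_of_nonneg_left k3 (by positivity : 0 ≤ s * Φ x)
    have k5 := mul_le_mul_of_nonneg_left w2 hs.le
    have k6 := mul_pos hc t0'
    rw [abs_le]; constructor <;> nlinarith
  · rw [le_div_iff₀ (by positivity)]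
    nlinarith [H.τE]

lemma dualC_smul (c : ℝ) (hc : 0 ≤ c) (g : Lp ℝ 2 μ) (hg : g ∈ dualC μ F) : c • g ∈ dualC μ F := by
  intro f hf
  have e : ∫ x, f x * (c • g : Lp ℝ 2 μ) x ∂μ = ∫ x, c * (f x * g x) ∂μ := by
    refine integral_congr_ae ?_
    filter_upwards [Lp.coeFn_smul c g] with x hx
    rw [hx, Pi.smul_apply, smul_eq_mul]; ring
  rw [e, integral_const_mul]
  exact mul_nonneg hc (hg f hf)

lemma int_sub_smul (g g' : Lp ℝ 2 μ) (a : ℝ) (f : Lp ℝ 2 μ) :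
    ∫ x, f x * (g - a • g' : Lp ℝ 2 μ) x ∂μ = ∫ x, f x * g x ∂μ - a * ∫ x, f x * g' x ∂μ := by
  rw [← integral_const_mul, ← integral_sub (lp_mul_int f g) ((lp_mul_int f g').const_mul a)]
  refine integral_congr_ae ?_
  filter_upwards [Lp.coeFn_sub g (a • g'), Lp.coeFn_smul a g'] with x h1 h2
  rw [h1, Pi.sub_apply, h2, Pi.smul_apply, smul_eq_mul]; ring

lemma coe_ae (g g' : Lp ℝ 2 μ) (a : ℝ) :
    ((g - a • g' : Lp ℝ 2 μ) : Y → ℝ) =ᵐ[μ] fun x => g x - a * g' x := by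
  filter_upwards [Lp.coeFn_sub g (a • g'), Lp.coeFn_smul a g'] with x h1 h2
  rw [h1, Pi.sub_apply, h2, Pi.smul_apply, smul_eq_mul]

lemma setint_sub_smul (g g' : Lp ℝ 2 μ) (a : ℝ) (B : Set Y) :
    ∫ x in B, (g - a • g' : Lp ℝ 2 μ) x ∂μ = ∫ x in B, g x ∂μ - a * ∫ x in B, g' x ∂μ := by
  rw [← integral_const_mul, ← integral_sub (lp_int g).integrableOn
    ((lp_int g').const_mul a).integrableOn]
  exact integral_congr_ae (ae_restrict_of_ae (coe_ae g g' a))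

lemma Kint_sub_smul (H : Good_s18 μ ν K F B Φ E τ) (g g' : Lp ℝ 2 μ) (a : ℝ) (y : Y) :
    ∫ z, K z y * (g - a • g' : Lp ℝ 2 μ) z ∂μ =
      ∫ z, K z y * g z ∂μ - a * ∫ z, K z y * g' z ∂μ := by
  rw [← integral_const_mul, ← integral_sub (K_int_s18 H g y) ((K_int_s18 H g' y).const_mul a)]
  refine integral_congr_ae ?_
  filter_upwards [coe_ae g g' a] with x h1
  rw [h1]; ring

lemma closed_low (g g' : Lp ℝ 2 μ) : IsClosed {a : ℝ | g - a • g' ∈ dualC μ F} := by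
  have : {a : ℝ | g - a • g' ∈ dualC μ F} =
      ⋂ f ∈ F, {a : ℝ | 0 ≤ ∫ x, f x * g x ∂μ - a * ∫ x, f x * g' x ∂μ} := by
    ext a
    simp only [Set.mem_ofPred_eq, mem_iInter, dualC, int_sub_smul]
  rw [this]
  refine isClosed_biInter fun f _ => isClosed_le continuous_const ?_
  fun_prop

lemma up_iff (g g' : Lp ℝ 2 μ) (b : ℝ) (hb : 0 < b) :
    b • g' - g ∈ dualC μ F ↔ g' - b⁻¹ • g ∈ dualC μ F := by
  constructor <;> intro h
  · have := dualC_smul b⁻¹ (inv_pos.2 hb).le _ h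
    rwa [smul_sub, smul_smul, inv_mul_cancel₀ hb.ne', one_smul] at this
  · have := dualC_smul b hb.le _ h
    rwa [smul_sub, smul_smul, mul_inv_cancel₀ hb.ne', one_smul] at this

lemma closed_up (g g' : Lp ℝ 2 μ) : IsClosed {b : ℝ | b • g' - g ∈ dualC μ F} := by
  have : {a : ℝ | a • g' - g ∈ dualC μ F} =
      ⋂ f ∈ F, {a : ℝ | 0 ≤ a * ∫ x, f x * g' x ∂μ - ∫ x, f x * g x ∂μ} := by
    ext a
    simp only [Set.mem_ofPred_eq, mem_iInter, dualC]
    refine forall₂_congr fun f hf => ?_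
    have e : ∫ x, f x * (a • g' - g : Lp ℝ 2 μ) x ∂μ =
        a * ∫ x, f x * g' x ∂μ - ∫ x, f x * g x ∂μ := by
      have h1 : a • g' - g = -(g - a • g') := by abel
      rw [h1]
      have h2 : ∫ x, f x * (-(g - a • g') : Lp ℝ 2 μ) x ∂μ =
          ∫ x, -(f x * (g - a • g' : Lp ℝ 2 μ) x) ∂μ := by
        refine integral_congr_ae ?_
        filter_upwards [Lp.coeFn_neg (g - a • g')] with x hx
        rw [hx, Pi.neg_apply]; ring
      rw [h2, integral_neg, int_sub_smul]; ring
    rw [e]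
  rw [this]
  refine isClosed_biInter fun f _ => isClosed_le continuous_const ?_
  fun_prop

lemma hilbert_le_s18 {Z : Type*} [AddCommGroup Z] [Module ℝ Z] (C : Set Z) (f g : Z) (a b : ℝ)
    (ha : 0 < a) (hb : 0 < b) (h1 : f - a • g ∈ C) (h2 : b • g - f ∈ C) (hg : g ≠ 0)
    (hbd : BddAbove {a : ℝ | 0 < a ∧ f - a • g ∈ C}) :
    hilbertD C f g ≤ ENNReal.ofReal (Real.log (b / a)) := by
  have hs : simC C f g ∧ g ≠ 0 := ⟨⟨⟨a, ha, h1⟩, ⟨b, hb, h2⟩⟩, hg⟩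
  unfold hilbertD
  rw [if_pos hs]
  have k1 : a ≤ minf C f g := le_csSup hbd ⟨ha, h1⟩
  have k2 : Msup C f g ≤ b := csInf_le ⟨0, fun x hx => hx.1.le⟩ ⟨hb, h2⟩
  have k3 : 0 ≤ Msup C f g := Real.sInf_nonneg fun x hx => hx.1.le
  rcases k3.eq_or_lt with h0 | h0
  · rw [← h0]; simp
  · refine ENNReal.ofReal_le_ofReal (Real.log_le_log (div_pos h0 (ha.trans_le k1)) ?_)
    exact div_le_div₀ hb.le k2 ha k1

lemma log_step (t σ₁ σ₂ η q : ℝ) (h1 : 1 ≤ σ₁) (h2 : 1 ≤ σ₂) (ht : σ₁ * σ₂ = t) (hη : 0 < η)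
    (hη1 : η ≤ 1) (hq : 0 ≤ q) (hq1 : q * (√t + 1) ≤ η / 8) (hq2 : q * (t - 1) ≤ 1 / 8) :
    0 < 1 + η * (σ₁ - 1) - q * (t - 1) ∧ 0 < 1 + η * (σ₂ - 1) - q * (t - 1) ∧
    Real.log (t / ((1 + η * (σ₁ - 1) - q * (t - 1)) * (1 + η * (σ₂ - 1) - q * (t - 1)))) ≤
      (1 - η / 2) * Real.log t := by
  have p1 : 0 ≤ η * (σ₁ - 1) := mul_nonneg hη.le (by linarith)
  have p2 : 0 ≤ η * (σ₂ - 1) := mul_nonneg hη.le (by linarith)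
  have ht1 : 1 ≤ t := by nlinarith
  set r := √t with hr
  have hr1 : 1 ≤ r := by rw [hr]; exact Real.one_le_sqrt.2 ht1
  have hrt : r * r = t := Real.mul_self_sqrt (by linarith)
  have hsum : 2 * r ≤ σ₁ + σ₂ := by
    have : (2 * r) ^ 2 ≤ (σ₁ + σ₂) ^ 2 := by nlinarith [sq_nonneg (σ₁ - σ₂)]
    exact abs_le_of_sq_le_sq' this (by linarith) |>.2
  set e := q * (t - 1) with he
  have he0 : 0 ≤ e := mul_nonneg hq (by linarith)
  set z := η * (r - 1) with hz
  have hz0 : 0 ≤ z := mul_nonneg hη.le (by linarith)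
  have hez : e ≤ z / 8 := by
    have : e = q * (r + 1) * (r - 1) := by rw [he, ← hrt]; ring
    rw [this]
    have := mul_le_mul_of_nonneg_right hq1 (by linarith : 0 ≤ r - 1)
    rw [hz]; linarith
  have hp : 2 * z ≤ η * (σ₁ - 1) + η * (σ₂ - 1) := by
    have := mul_le_mul_of_nonneg_left hsum hη.le
    rw [hz]; linarith
  set x := η * (σ₁ - 1)
  set y := η * (σ₂ - 1)
  have hP : 1 + z ≤ (1 + x - e) * (1 + y - e) := by
    have a1 : 0 ≤ x * y := mul_nonneg p1 p2
    have a2 : e * (x + y) ≤ 1 / 8 * (x + y) := mul_le_mul_of_nonneg_right hq2 (by linarith)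
    nlinarith [sq_nonneg e]
  refine ⟨by linarith, by linarith, ?_⟩
  have hP0 : 0 < (1 + x - e) * (1 + y - e) := by linarith
  rw [Real.log_div (by linarith) hP0.ne']
  have b1 : r ^ η ≤ 1 + z := by
    have := Real.geom_mean_le_arith_mean2_weighted hη.le (by linarith : 0 ≤ 1 - η)
      (by linarith : 0 ≤ r) zero_le_one (by ring)
    rw [Real.one_rpow] at this
    rw [hz]; linarith
  have b2 : η * Real.log r ≤ Real.log ((1 + x - e) * (1 + y - e)) := by
    rw [← Real.log_rpow (by linarith)]
    exact Real.log_le_log (Real.rpow_pos_of_pos (by linarith) _) (b1.trans hP)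
  have b3 : Real.log t = 2 * Real.log r := by
    rw [← hrt, Real.log_mul (by linarith) (by linarith)]; ring
  rw [b3]
  linarith

lemma bdd_low (H : Good_s18 μ ν K F B Φ E τ) (f g : Lp ℝ 2 μ) (_hg : 0 < ∫ z in B, g z ∂μ) (a : ℝ)
    (h : f - a • g ∈ dualC μ F) : a * ∫ z in B, g z ∂μ ≤ ∫ z in B, f z ∂μ := by
  have := G_nonneg H _ h
  rw [setint_sub_smul] at this
  linarith

lemma ne_zero_of_int (g : Lp ℝ 2 μ) (hg : 0 < ∫ z in B, g z ∂μ) : g ≠ 0 := by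
  rintro rfl
  have : ∫ z in B, (0 : Lp ℝ 2 μ) z ∂μ = 0 := by
    rw [integral_congr_ae (ae_restrict_of_ae (Lp.coeFn_zero ℝ 2 μ))]
    simp
  linarith

lemma T_intB (H : Good_s18 μ ν K F B Φ E τ) {h : Y → ℝ} {s : ℝ} (hh : HB Φ h s)
    (hm : MemLp (fun x => (∫ y, K x y * (h y)⁻¹ ∂ν)⁻¹) 2 μ) :
    0 < ∫ z in B, (hm.toLp _ : Lp ℝ 2 μ) z ∂μ := by
  rw [integral_congr_ae (ae_restrict_of_ae hm.coeFn_toLp)]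
  have := setIntegral_ge_of_const_le (c := s / (2 * E)) H.hB (measure_ne_top μ B)
    (fun x _ => T_lower H hh x) (hm.integrable (by norm_num)).integrableOn
  refine lt_of_lt_of_le ?_ this
  rw [smul_eq_mul]
  have := H.μB
  have h2 := hh.spos
  have h3 := H.E_pos
  exact mul_pos (by linarith) (by positivity)

lemma mkHB (H : Good_s18 μ ν K F B Φ E τ) (g : Lp ℝ 2 μ) (hg : g ∈ dualC μ F)
    (hn : ∀ᵐ x ∂μ, 0 ≤ g x) (hi : 0 < ∫ x, g x ∂μ) :
    HB Φ (fun y => ∫ z, K z y * g z ∂μ) (∫ z in B, g z ∂μ) :=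
  ⟨h_meas H g, s_pos H g hg hi, h_lower H g hn, h_upper H g hg hn⟩

lemma step_low_g (H : Good_s18 μ ν K F B Φ E τ) (g g' : Lp ℝ 2 μ) (hg : g ∈ dualC μ F)
    (hn : ∀ᵐ x ∂μ, 0 ≤ g x) (hi : 0 < ∫ x, g x ∂μ) (hg' : g' ∈ dualC μ F)
    (hn' : ∀ᵐ x ∂μ, 0 ≤ g' x) (hi' : 0 < ∫ x, g' x ∂μ) (a b : ℝ) (hb : 0 < b)
    (h1 : g - a • g' ∈ dualC μ F) (h2 : g' - b⁻¹ • g ∈ dualC μ F)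
    (hm : MemLp (fun x => (∫ y, K x y * (∫ z, K z y * g z ∂μ)⁻¹ ∂ν)⁻¹) 2 μ)
    (hm' : MemLp (fun x => (∫ y, K x y * (∫ z, K z y * g' z ∂μ)⁻¹ ∂ν)⁻¹) 2 μ) :
    hm.toLp _ - (a + (∫ z in B, g z ∂μ - a * ∫ z in B, g' z ∂μ) / (8 * E * ∫ z in B, g' z ∂μ)
      - 400 * τ * E ^ 3 * (b - a)) • hm'.toLp _ ∈ dualC μ F := by
  have n1 := G_nonneg H _ h1
  have n2 := G_nonneg H _ h2
  rw [setint_sub_smul] at n1 n2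
  have key : b * (∫ z in B, g' z ∂μ - b⁻¹ * ∫ z in B, g z ∂μ) =
      b * ∫ z in B, g' z ∂μ - ∫ z in B, g z ∂μ := by
    field_simp
  refine step_low H (mkHB H g hg hn hi) (mkHB H g' hg' hn' hi') a b n1 ?_ ?_ ?_ ?_ hm hm'
  · have := mul_nonneg hb.le n2
    rwa [key] at this
  · intro y hy
    have := G_B H _ h1 y hy
    rwa [setint_sub_smul, Kint_sub_smul H] at this
  · intro y
    have := G_all H _ h1 y
    rwa [setint_sub_smul, Kint_sub_smul H] at this
  · intro y
    have := G_all H _ h2 y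
    rw [setint_sub_smul, Kint_sub_smul H] at this
    have := mul_le_mul_of_nonneg_left this hb.le
    have k2 : b * (∫ z, K z y * g' z ∂μ - b⁻¹ * ∫ z, K z y * g z ∂μ) =
      b * ∫ z, K z y * g' z ∂μ - ∫ z, K z y * g z ∂μ := by
      field_simp
    rw [k2] at this
    rw [← key]
    linarith

theorem main_abs (H : Good_s18 μ ν K F B Φ E τ) (g g' : Lp ℝ 2 μ) (hg : g ∈ dualC μ F)
    (hn : ∀ᵐ x ∂μ, 0 ≤ g x) (hi : 0 < ∫ x, g x ∂μ) (hg' : g' ∈ dualC μ F)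
    (hn' : ∀ᵐ x ∂μ, 0 ≤ g' x) (hi' : 0 < ∫ x, g' x ∂μ) :
    ∃ (hm : MemLp (fun x => (∫ y, K x y * (∫ z, K z y * g z ∂μ)⁻¹ ∂ν)⁻¹) 2 μ)
      (hm' : MemLp (fun x => (∫ y, K x y * (∫ z, K z y * g' z ∂μ)⁻¹ ∂ν)⁻¹) 2 μ),
      hilbertD (dualC μ F) (hm.toLp _) (hm'.toLp _) ≤
        ENNReal.ofReal (1 - 1 / (16 * E)) * hilbertD (dualC μ F) g g' := by
  have hh := mkHB H g hg hn hi
  have hh' := mkHB H g' hg' hn' hi'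
  refine ⟨T_mem H hh, T_mem H hh', ?_⟩
  generalize T_mem H hh = hm
  generalize T_mem H hh' = hm'
  have hE := H.E_pos
  have hE1 := H.E_ge
  have hτ := H.τ_pos
  set s := ∫ z in B, g z ∂μ with hs_def
  set s' := ∫ z in B, g' z ∂μ with hs'_def
  have hs : 0 < s := hh.spos
  have hs' : 0 < s' := hh'.spos
  have hTB := T_intB H hh hm
  have hTB' := T_intB H hh' hm'
  have hT0 := ne_zero_of_int _ hTB'
  have hTbd : BddAbove {a : ℝ | 0 < a ∧ hm.toLp _ - a • hm'.toLp _ ∈ dualC μ F} := by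
    refine ⟨(∫ z in B, (hm.toLp _ : Lp ℝ 2 μ) z ∂μ) / (∫ z in B, (hm'.toLp _ : Lp ℝ 2 μ) z ∂μ),
      fun a ha => ?_⟩
    exact (le_div_iff₀ hTB').2 (bdd_low H _ _ hTB' a ha.2)
  have hη : 1 / (16 * E) ≤ 1 / 2 := by
    rw [div_le_div_iff₀ (by positivity) (by norm_num)]; linarith
  have hη0 : 0 < 1 / (16 * E) := by positivity
  by_cases hsim : simC (dualC μ F) g g' ∧ g' ≠ 0
  swap
  · have : hilbertD (dualC μ F) g g' = ⊤ := by unfold hilbertD; rw [if_neg hsim]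
    rw [this, ENNReal.mul_top]
    · exact le_top
    · simp only [ne_eq, ENNReal.ofReal_eq_zero, not_le]; linarith
  have hd : hilbertD (dualC μ F) g g' =
      ENNReal.ofReal (Real.log (Msup (dualC μ F) g g' / minf (dualC μ F) g g')) := by
    unfold hilbertD; rw [if_pos hsim]
  obtain ⟨⟨⟨a0, ha0, ha0'⟩, ⟨b0, hb0, hb0'⟩⟩, -⟩ := hsim
  have hbdS : BddAbove {a : ℝ | 0 < a ∧ g - a • g' ∈ dualC μ F} :=
    ⟨s / s', fun a ha => (le_div_iff₀ hs').2 (bdd_low H _ _ hs' a ha.2)⟩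
  set a := minf (dualC μ F) g g' with ha_def
  set b := Msup (dualC μ F) g g' with hb_def
  have hapos : 0 < a := ha0.trans_le (le_csSup hbdS ⟨ha0, ha0'⟩)
  have hamem : g - a • g' ∈ dualC μ F := by
    have h1 : a ∈ closure {a : ℝ | 0 < a ∧ g - a • g' ∈ dualC μ F} :=
      csSup_mem_closure ⟨a0, ha0, ha0'⟩ hbdS
    exact closure_minimal (fun x hx => hx.2) (closed_low g g') h1
  have hbge : s / s' ≤ b := by
    refine le_csInf ⟨b0, hb0, hb0'⟩ fun x hx => ?_
    have h1 := bdd_low H _ _ hs _ ((up_iff g g' x hx.1).1 hx.2)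
    rw [inv_mul_le_iff₀ hx.1] at h1
    rwa [div_le_iff₀ hs']
  have hbpos : 0 < b := lt_of_lt_of_le (by positivity) hbge
  have hbmem : b • g' - g ∈ dualC μ F := by
    have h1 : b ∈ closure {b : ℝ | 0 < b ∧ b • g' - g ∈ dualC μ F} :=
      csInf_mem_closure ⟨b0, hb0, hb0'⟩ ⟨0, fun x hx => hx.1.le⟩
    exact closure_minimal (fun x hx => hx.2) (closed_up g g') h1
  have hbmem' := (up_iff g g' b hbpos).1 hbmem
  have hale : a * s' ≤ s := bdd_low H _ _ hs' a hamem
  have hble : s ≤ b * s' := (div_le_iff₀ hs').1 hbge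
  have hab : a ≤ b := by
    have : a * s' ≤ b * s' := hale.trans hble
    exact le_of_mul_le_mul_right this hs'
  set t := b / a with ht_def
  have ht1 : 1 ≤ t := (one_le_div hapos).2 hab
  have hlt : 0 ≤ Real.log t := Real.log_nonneg ht1
  rw [hd, ← ENNReal.ofReal_mul (by linarith)]
  by_cases hbig : (256 * E ^ 4) ^ 2 ≤ t
  · -- far apart
    have d1 := step_diam H hh hh' hm hm'
    have d2 := step_diam H hh' hh hm' hm
    have d3 := (up_iff (hm.toLp _) (hm'.toLp _) (s' / (16 * E ^ 2 * s))⁻¹ (by positivity)).2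
      (by rwa [inv_inv])
    refine (hilbert_le_s18 _ _ _ _ _ (by positivity) (by positivity) d1 d3 hT0 hTbd).trans ?_
    refine ENNReal.ofReal_le_ofReal ?_
    have e1 : (s' / (16 * E ^ 2 * s))⁻¹ / (s / (16 * E ^ 2 * s')) = 256 * E ^ 4 := by
      field_simp; norm_num
    rw [e1]
    have e2 := Real.log_le_log (by positivity) hbig
    rw [Real.log_pow] at e2
    push_cast at e2
    nlinarith
  · push Not at hbig
    have l1 := step_low_g H g g' hg hn hi hg' hn' hi' a b hbpos hamem hbmem' hm hm'
    have l2 := step_low_g H g' g hg' hn' hi' hg hn hi b⁻¹ a⁻¹ (inv_pos.2 hapos) hbmem'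
      (by rwa [inv_inv]) hm' hm
    rw [← hs_def, ← hs'_def] at l1 l2
    have r1 : √t ≤ 256 * E ^ 4 := (Real.sqrt_le_left (by positivity)).2 hbig.le
    have kk : τ * E ^ 11 * 1000 ^ 9 ≤ 1 := by
      have k1 : (1000 : ℝ) ^ 9 ≤ E ^ 9 := pow_le_pow_left₀ (by norm_num) hE1 9
      have k2 := mul_le_mul_of_nonneg_left k1 (by positivity : 0 ≤ τ * E ^ 11)
      have k3 : τ * E ^ 11 * E ^ 9 = τ * E ^ 20 := by ring
      linarith [H.τ_le]
    have kk8 : τ * E ^ 8 ≤ τ * E ^ 11 :=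
      mul_le_mul_of_nonneg_left (pow_le_pow_right₀ (by linarith) (by norm_num)) hτ.le
    obtain ⟨P1, P2, P3⟩ := log_step t (s / (a * s')) (b * s' / s) (1 / (8 * E)) (400 * τ * E ^ 3)
      ((one_le_div (by positivity)).2 hale) ((one_le_div hs).2 hble)
      (by rw [ht_def]; field_simp) (by positivity)
      (by rw [div_le_one (by positivity)]; linarith) (by positivity) (by
        have k1 : √t + 1 ≤ 257 * E ^ 4 := by
          have : 1 ≤ E ^ 4 := one_le_pow₀ (by linarith)
          linarith
        have k2 := mul_le_mul_of_nonneg_left k1 (by positivity : 0 ≤ 400 * τ * E ^ 3)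
        refine k2.trans ?_
        rw [div_div, le_div_iff₀ (by positivity)]
        have k3 : 400 * τ * E ^ 3 * (257 * E ^ 4) * (8 * E * 8) = 6579200 * (τ * E ^ 8) := by ring
        rw [k3]
        linarith) (by
        have k2 := mul_le_mul_of_nonneg_left (by linarith : t - 1 ≤ (256 * E ^ 4) ^ 2)
          (by positivity : 0 ≤ 400 * τ * E ^ 3)
        refine k2.trans ?_
        have k3 : 400 * τ * E ^ 3 * (256 * E ^ 4) ^ 2 = 26214400 * (τ * E ^ 11) := by ring
        rw [k3]
        linarith)
    have e1 : a + (s - a * s') / (8 * E * s') - 400 * τ * E ^ 3 * (b - a) =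
        a * (1 + 1 / (8 * E) * (s / (a * s') - 1) - 400 * τ * E ^ 3 * (t - 1)) := by
      rw [ht_def]; field_simp
    have e2 : b⁻¹ + (s' - b⁻¹ * s) / (8 * E * s) - 400 * τ * E ^ 3 * (a⁻¹ - b⁻¹) =
        b⁻¹ * (1 + 1 / (8 * E) * (b * s' / s - 1) - 400 * τ * E ^ 3 * (t - 1)) := by
      rw [ht_def]; field_simp
    rw [e1] at l1
    rw [e2] at l2
    set Q1 := 1 + 1 / (8 * E) * (s / (a * s') - 1) - 400 * τ * E ^ 3 * (t - 1)
    set Q2 := 1 + 1 / (8 * E) * (b * s' / s - 1) - 400 * τ * E ^ 3 * (t - 1)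
    have l3 := (up_iff (hm.toLp _) (hm'.toLp _) (b⁻¹ * Q2)⁻¹ (by positivity)).2
      (by rwa [inv_inv])
    refine (hilbert_le_s18 _ _ _ _ _ (by positivity) (by positivity) l1 l3 hT0 hTbd).trans ?_
    refine ENNReal.ofReal_le_ofReal ?_
    have e3 : (b⁻¹ * Q2)⁻¹ / (a * Q1) = t / (Q1 * Q2) := by
      rw [ht_def]; field_simp
    rw [e3]
    refine P3.trans (le_of_eq ?_)
    congr 2
    field_simp; norm_num

end abstract_part

section concrete_part

lemma of_lint {ρ : Measure X} {S : Set X} {w : X → ℝ} (hw : Measurable w) (hw0 : ∀ x, 0 ≤ w x)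
    {C : ℝ} (hC : 0 ≤ C) (h : ∫⁻ x in S, ENNReal.ofReal (w x) ∂ρ ≤ ENNReal.ofReal C) :
    IntegrableOn w S ρ ∧ ∫ x in S, w x ∂ρ ≤ C := by
  refine ⟨⟨hw.aestronglyMeasurable, ?_⟩, ?_⟩
  · rw [hasFiniteIntegral_iff_ofReal (Eventually.of_forall hw0)]
    exact h.trans_lt ENNReal.ofReal_lt_top
  · rw [integral_eq_lintegral_of_nonneg_ae (Eventually.of_forall hw0) hw.aestronglyMeasurable]
    exact ENNReal.toReal_le_of_le_ofReal hC h

lemma tail_lemma (x₀ : X) (p q m : ℝ) (hp : 0 < p) (hm : 1 ≤ m)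
    (h4 : ∀ r, m ≤ r → 4 * (2 * r) ^ p + 21 * r ^ p ≤ r ^ q)
    (h5 : 2 / (1 - ((2 : ℝ) ^ p)⁻¹) ≤ m ^ p)
    (ρ : Measure X) (A : ℝ≥0∞)
    (hρ : ∀ r, m ≤ r → ρ (closedBall x₀ r)ᶜ ≤ A * ENNReal.ofReal (Real.exp (-r ^ q))) :
    ∫⁻ x in (closedBall x₀ m)ᶜ, ENNReal.ofReal (Real.exp ((max (dist x x₀) m) ^ p) ^ 4) ∂ρ ≤
      A * ENNReal.ofReal (Real.exp (-(20 * m ^ p)) / 2) := by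
  have hm0 : 0 < m := by linarith
  set rr : ℕ → ℝ := fun k => 2 ^ k * m with hrr
  have hrm : ∀ k, m ≤ rr k := fun k => by
    have : (1 : ℝ) ≤ 2 ^ k := one_le_pow₀ (by norm_num)
    simp only [hrr]; nlinarith
  have h2p : 1 < (2 : ℝ) ^ p := Real.one_lt_rpow (by norm_num) hp
  have hmp : 0 < m ^ p := Real.rpow_pos_of_pos hm0 p
  have hinv : ((2 : ℝ) ^ p)⁻¹ < 1 := inv_lt_one_of_one_lt₀ h2p
  have hinv0 : 0 ≤ ((2 : ℝ) ^ p)⁻¹ := by positivity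
  -- pointwise
  have hpt : ∀ x, (closedBall x₀ m)ᶜ.indicator
      (fun x => ENNReal.ofReal (Real.exp ((max (dist x x₀) m) ^ p) ^ 4)) x ≤
      ∑' k, (closedBall x₀ (rr k))ᶜ.indicator
        (fun _ => ENNReal.ofReal (Real.exp (4 * (2 * rr k) ^ p))) x := by
    intro x
    by_cases hx : x ∈ (closedBall x₀ m)ᶜ
    swap
    · rw [indicator_of_notMem hx]; exact zero_le
    rw [indicator_of_mem hx]
    have hd : m < dist x x₀ := by simpa [mem_closedBall] using hx
    have hex : ∃ k : ℕ, dist x x₀ ≤ 2 ^ k * m := by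
      obtain ⟨k, hk⟩ := pow_unbounded_of_one_lt (dist x x₀) (by norm_num : (1 : ℝ) < 2)
      refine ⟨k, ?_⟩
      have : (0 : ℝ) < 2 ^ k := by positivity
      nlinarith
    classical
    obtain ⟨k, hk⟩ : ∃ k, Nat.find hex = k + 1 := by
      refine Nat.exists_eq_succ_of_ne_zero fun h0 => ?_
      have := Nat.find_spec hex
      rw [h0] at this
      simp at this
      linarith
    have k1 := Nat.find_spec hex
    rw [hk] at k1
    have k2 := Nat.find_min hex (m := k) (by omega)
    push Not at k2
    refine le_trans ?_ (ENNReal.le_tsum k)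
    have hxk : x ∈ (closedBall x₀ (rr k))ᶜ := by
      simp only [mem_compl_iff, mem_closedBall, not_le]; exact k2
    rw [indicator_of_mem hxk]
    refine ENNReal.ofReal_le_ofReal ?_
    rw [max_eq_left hd.le, ← Real.exp_nat_mul]
    refine Real.exp_le_exp.2 ?_
    push_cast
    refine mul_le_mul_of_nonneg_left ?_ (by norm_num)
    refine Real.rpow_le_rpow dist_nonneg ?_ hp.le
    rw [pow_succ] at k1
    simp only [hrr]; linarith
  rw [← lintegral_indicator isClosed_closedBall.measurableSet.compl]
  refine (lintegral_mono hpt).trans ?_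
  rw [lintegral_tsum fun k => (measurable_const.indicator
    isClosed_closedBall.measurableSet.compl).aemeasurable]
  set S : ℕ → ℝ := fun k => Real.exp (-(20 * m ^ p)) / m ^ p * (((2 : ℝ) ^ p)⁻¹) ^ k with hS
  have hS0 : ∀ k, 0 ≤ S k := fun k => by simp only [hS]; positivity
  have hgs : HasSum S (Real.exp (-(20 * m ^ p)) / m ^ p * (1 - ((2 : ℝ) ^ p)⁻¹)⁻¹) :=
    (hasSum_geometric_of_lt_one hinv0 hinv).mul_left _
  have hterm : ∀ k, ∫⁻ x, (closedBall x₀ (rr k))ᶜ.indicator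
        (fun _ => ENNReal.ofReal (Real.exp (4 * (2 * rr k) ^ p))) x ∂ρ ≤
        A * ENNReal.ofReal (S k) := by
    intro k
    rw [lintegral_indicator_const isClosed_closedBall.measurableSet.compl]
    refine (mul_le_mul_right (hρ (rr k) (hrm k)) _).trans ?_
    rw [mul_left_comm, ← ENNReal.ofReal_mul (Real.exp_pos _).le, ← Real.exp_add]
    refine mul_le_mul_right (ENNReal.ofReal_le_ofReal ?_) _
    have a1 := h4 (rr k) (hrm k)
    have a2 : m ^ p ≤ rr k ^ p := Real.rpow_le_rpow hm0.le (hrm k) hp.le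
    have a3 : rr k ^ p = (2 ^ p) ^ k * m ^ p := by
      simp only [hrr]
      rw [Real.mul_rpow (by positivity) hm0.le, ← Real.rpow_natCast, ← Real.rpow_mul (by norm_num),
        mul_comm (k : ℝ) p, Real.rpow_mul (by norm_num), Real.rpow_natCast]
    have a4 : Real.exp (-rr k ^ p) ≤ (rr k ^ p)⁻¹ := by
      rw [Real.exp_neg]
      refine inv_anti₀ (by rw [a3]; positivity) ?_
      linarith [Real.add_one_le_exp (rr k ^ p)]
    have a5 : Real.exp (4 * (2 * rr k) ^ p + -rr k ^ q) ≤
        Real.exp (-(20 * m ^ p)) * Real.exp (-rr k ^ p) := by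
      rw [← Real.exp_add]
      exact Real.exp_le_exp.2 (by linarith)
    refine a5.trans ((mul_le_mul_of_nonneg_left a4 (Real.exp_pos _).le).trans (le_of_eq ?_))
    simp only [hS]
    rw [a3, inv_pow]
    field_simp
  refine (ENNReal.tsum_le_tsum hterm).trans ?_
  rw [ENNReal.tsum_mul_left, ← ENNReal.ofReal_tsum_of_nonneg hS0 hgs.summable, hgs.tsum_eq]
  refine mul_le_mul_right (ENNReal.ofReal_le_ofReal ?_) _
  have hpos : 0 < 1 - ((2 : ℝ) ^ p)⁻¹ := by linarith
  rw [div_le_iff₀ hpos] at h5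
  rw [← div_eq_mul_inv, div_div]
  exact div_le_div_of_nonneg_left (Real.exp_pos _).le (by norm_num) h5

lemma build_good (μ ν : Measure X) [IsProbabilityMeasure μ] [IsProbabilityMeasure ν]
    (x₀ : X) (c : X → X → ℝ) (hcmeas : Measurable (Function.uncurry c))
    (hcnn : ∀ x y, 0 ≤ c x y) (ε : ℝ) (hε : 0 < ε) (p q m : ℝ) (hp : 0 < p) (hm : 1 ≤ m)
    (h1 : ∀ r, m ≤ r → ∀ x ∈ closedBall x₀ r, ∀ y ∈ closedBall x₀ r, c x y ≤ ε * r ^ p)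
    (h2 : ∀ r, m ≤ r → μ.real (closedBall x₀ r)ᶜ ≤ Real.exp (-(20 * m ^ p)) * Real.exp (-r ^ q))
    (h3 : ∀ r, m ≤ r → ν.real (closedBall x₀ r)ᶜ ≤ Real.exp (-(20 * m ^ p)) * Real.exp (-r ^ q))
    (h4 : ∀ r, m ≤ r → 4 * (2 * r) ^ p + 21 * r ^ p ≤ r ^ q)
    (h5 : 2 / (1 - ((2 : ℝ) ^ p)⁻¹) ≤ m ^ p) (h6 : 1000 ≤ m ^ p) :
    Good_s18 μ ν (fun x y => Real.exp (-c x y / ε))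
      (Fcone μ x₀ m m (fun r => Real.exp (-r ^ q)) (fun r => Real.exp (-r ^ q)))
      (closedBall x₀ m) (fun x => Real.exp ((max (dist x x₀) m) ^ p)) (Real.exp (m ^ p))
      (Real.exp (-(20 * m ^ p))) := by
  set τ := Real.exp (-(20 * m ^ p)) with hτdef
  set Φ : X → ℝ := fun x => Real.exp ((max (dist x x₀) m) ^ p) with hΦ
  have hτ : 0 < τ := Real.exp_pos _
  have hτ1 : τ ≤ 1 / 2 := by
    have := Real.exp_le_exp.2 (by linarith : -(20 * m ^ p) ≤ -1)
    have h3 : Real.exp (-1) ≤ 1 / 2 := by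
      rw [Real.exp_neg, ← one_div]
      exact div_le_div_of_nonneg_left zero_le_one (by norm_num) (by linarith [Real.add_one_le_exp 1])
    linarith
  have hm0 : 0 < m := by linarith
  have hα : ∀ r, m ≤ r → Real.exp (-r ^ q) ≤ 1 := fun r hr => by
    rw [Real.exp_le_one_iff]
    linarith [Real.rpow_nonneg (by linarith : 0 ≤ r) q]
  have hBm : ∀ r, MeasurableSet (closedBall x₀ r) := fun r => isClosed_closedBall.measurableSet
  have hΦm : Measurable Φ := by
    simp only [hΦ]
    have : Measurable fun x : X => dist x x₀ := (continuous_id.dist continuous_const).measurable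
    exact Real.measurable_exp.comp ((this.max measurable_const).pow_const p)
  have hΦ0 : ∀ x, 0 < Φ x := fun x => Real.exp_pos _
  -- tails of probability measures
  have hprob : ∀ (ρ : Measure X) [IsProbabilityMeasure ρ],
      (∀ r, m ≤ r → ρ.real (closedBall x₀ r)ᶜ ≤ τ * Real.exp (-r ^ q)) →
      1 / 2 ≤ ρ.real (closedBall x₀ m) ∧ IntegrableOn (fun x => Φ x ^ 4) (closedBall x₀ m)ᶜ ρ ∧
        ∫ x in (closedBall x₀ m)ᶜ, Φ x ^ 4 ∂ρ ≤ τ := by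
    intro ρ _ hρ
    constructor
    · have k1 := hρ m le_rfl
      rw [probReal_compl_eq_one_sub (hBm m)] at k1
      have k2 := hα m le_rfl
      nlinarith
    · refine of_lint (hΦm.pow_const 4) (fun x => (pow_pos (hΦ0 x) 4).le) hτ.le ?_
      refine (tail_lemma x₀ p q m hp hm h4 h5 ρ 1 fun r hr => ?_).trans ?_
      · rw [one_mul, ← ofReal_measureReal]
        refine ENNReal.ofReal_le_ofReal ((hρ r hr).trans ?_)
        have := Real.exp_pos (-r ^ q)
        nlinarith
      · rw [one_mul]
        exact ENNReal.ofReal_le_ofReal (by linarith)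
  obtain ⟨μ1, μ2, -⟩ := hprob μ h2
  obtain ⟨ν1, ν2, ν3⟩ := hprob ν h3
  have hK : ∀ x y r, m ≤ r → x ∈ closedBall x₀ r → y ∈ closedBall x₀ r →
      1 ≤ Real.exp (-c x y / ε) * Real.exp (r ^ p) := by
    intro x y r hr hx hy
    rw [← Real.exp_add]
    refine Real.one_le_exp ?_
    have := h1 r hr x hx y hy
    have h' : c x y / ε ≤ r ^ p := by rw [div_le_iff₀ hε]; linarith
    rw [neg_div]; linarith
  have hFF : ∀ f ∈ Fcone μ x₀ m m (fun r => Real.exp (-r ^ q)) (fun r => Real.exp (-r ^ q)),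
      IntegrableOn (fun x => |f x| * Φ x ^ 4) (closedBall x₀ m)ᶜ μ ∧
        ∫ x in (closedBall x₀ m)ᶜ, |f x| * Φ x ^ 4 ∂μ ≤ τ * ∫ x, f x ∂μ := by
    intro f hf
    obtain ⟨-, hf2, hf3⟩ := hf
    have hfI : Integrable f μ := (Lp.memLp f).integrable (by norm_num)
    have hfm : Measurable f := (Lp.stronglyMeasurable f).measurable
    have hA : 0 ≤ ∫ x, f x ∂μ := by
      have k1 := hf2 m le_rfl
      have k2 : 0 ≤ ∫ x in (closedBall x₀ m)ᶜ, max (f x) 0 ∂μ :=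
        integral_nonneg fun x => le_max_right _ _
      exact nonneg_of_mul_nonneg_right (k2.trans k1) (Real.exp_pos _)
    have habs : Measurable fun x => ENNReal.ofReal |f x| := hfm.abs.ennreal_ofReal
    refine of_lint (hfm.abs.mul (hΦm.pow_const 4))
      (fun x => mul_nonneg (abs_nonneg _) (pow_pos (hΦ0 x) 4).le) (mul_nonneg hτ.le hA) ?_
    have key := tail_lemma x₀ p q m hp hm h4 h5 (μ.withDensity fun x => ENNReal.ofReal |f x|)
      (ENNReal.ofReal (2 * ∫ x, f x ∂μ)) (fun r hr => by
        rw [withDensity_apply _ (hBm r).compl,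
          ← ofReal_integral_eq_lintegral_ofReal hfI.abs.integrableOn
            (Eventually.of_forall fun x => abs_nonneg _),
          ← ENNReal.ofReal_mul (by linarith)]
        refine ENNReal.ofReal_le_ofReal ?_
        have e : ∀ x, |f x| = max (f x) 0 + max (-(f x)) 0 := fun x => by
          rcases le_total 0 (f x) with h | h
          · rw [abs_of_nonneg h, max_eq_left h, max_eq_right (by linarith), add_zero]
          · rw [abs_of_nonpos h, max_eq_right h, max_eq_left (by linarith), zero_add]
        simp only [e]
        rw [integral_add hfI.pos_part.integrableOn hfI.neg_part.integrableOn]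
        have k1 := hf2 r hr
        have k2 := hf3 r hr
        simp only at k1 k2
        linarith)
    rw [setLIntegral_withDensity_eq_setLIntegral_mul _ habs
      (hΦm.pow_const 4).ennreal_ofReal (hBm m).compl,
      ← ENNReal.ofReal_mul (by linarith)] at key
    refine le_trans (le_of_eq ?_) (key.trans (ENNReal.ofReal_le_ofReal (le_of_eq ?_)))
    · refine lintegral_congr fun x => ?_
      exact ENNReal.ofReal_mul (abs_nonneg _)
    · simp only [hτdef]; ring
  have hΦ1 : ∀ x, 1 ≤ Φ x := fun x =>
    Real.one_le_exp (Real.rpow_nonneg (hm0.le.trans (le_max_right _ _)) p)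
  have hΦ2 : MemLp Φ 2 μ := by
    rw [memLp_two_iff_integrable_sq hΦm.aestronglyMeasurable]
    rw [← integrableOn_univ, ← union_compl_self (closedBall x₀ m)]
    refine IntegrableOn.union ?_ ?_
    · refine IntegrableOn.congr_fun (f := fun _ => Real.exp (m ^ p) ^ 2)
        (integrable_const _).integrableOn (fun x hx => ?_) (hBm m)
      simp only [hΦ]
      rw [max_eq_right (mem_closedBall.1 hx)]
    · refine Integrable.mono' μ2 (hΦm.pow_const 2).aestronglyMeasurable
        (Eventually.of_forall fun x => ?_)
      rw [Real.norm_of_nonneg (pow_pos (hΦ0 x) 2).le]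
      exact pow_le_pow_right₀ (hΦ1 x) (by norm_num)
  refine ⟨hBm m, ?_, fun _ _ => Real.exp_pos _, ?_, hΦm, ?_, ?_, ?_, ?_, ?_, hτ, ?_, μ1, ν1, ?_,
    fun f hf => (hFF f hf).1, fun f hf => (hFF f hf).2, fun f hf => hf.1, ν2, ν3, hΦ2⟩
  · exact Real.measurable_exp.comp ((hcmeas.neg).div_const ε)
  · intro x y
    rw [Real.exp_le_one_iff, neg_div]
    have := div_nonneg (hcnn x y) hε.le
    linarith
  · intro x
    exact Real.exp_le_exp.2 (Real.rpow_le_rpow hm0.le (le_max_right _ _) hp.le)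
  · intro x hx
    simp only [hΦ]
    rw [max_eq_right (mem_closedBall.1 hx)]
  · intro x y hy
    refine hK x y _ (le_max_right _ _) (mem_closedBall.2 (le_max_left _ _)) ?_
    exact closedBall_subset_closedBall (le_max_right _ _) hy
  · intro x hx y
    refine hK x y _ (le_max_right _ _) ?_ (mem_closedBall.2 (le_max_left _ _))
    exact closedBall_subset_closedBall (le_max_right _ _) hx
  · linarith [Real.add_one_le_exp (m ^ p)]
  · rw [hτdef, ← Real.exp_nat_mul, ← Real.exp_add]
    push_cast
    simp
  · intro f hf hf0 hf1 hfi
    have hfI : Integrable f μ := hf.integrable (by norm_num)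
    have hco := hf.coeFn_toLp
    have hI : τ ≤ ∫ x, f x ∂μ := by
      rw [← integral_add_compl (hBm m) hfI]
      have k1 : ∫ x in (closedBall x₀ m)ᶜ, (-1 : ℝ) ∂μ ≤ ∫ x in (closedBall x₀ m)ᶜ, f x ∂μ :=
        setIntegral_mono_on (integrable_const _).integrableOn hfI.integrableOn (hBm m).compl
          fun x hx => (abs_le.1 (hf1 x hx)).1
      rw [setIntegral_const, smul_eq_mul] at k1
      have k2 := h2 m le_rfl
      have k3 := hα m le_rfl
      nlinarith
    have gen : ∀ r, m ≤ r → ∀ w : X → ℝ, Integrable w μ → (∀ x, x ∉ closedBall x₀ m → w x ≤ 1) →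
        ∫ x in (closedBall x₀ r)ᶜ, w x ∂μ ≤ Real.exp (-r ^ q) * ∫ x, f x ∂μ := by
      intro r hr w hw hw1
      have k1 : ∫ x in (closedBall x₀ r)ᶜ, w x ∂μ ≤ ∫ x in (closedBall x₀ r)ᶜ, (1 : ℝ) ∂μ :=
        setIntegral_mono_on hw.integrableOn (integrable_const _).integrableOn (hBm r).compl
          fun x hx => hw1 x fun hx' => hx (closedBall_subset_closedBall hr hx')
      rw [setIntegral_const, smul_eq_mul, mul_one] at k1
      have k2 := h2 r hr
      have k3 := mul_le_mul_of_nonneg_left hI (Real.exp_pos (-r ^ q)).le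
      linarith
    have eI : ∫ x, (hf.toLp f) x ∂μ = ∫ x, f x ∂μ := integral_congr_ae hco
    refine ⟨?_, fun r hr => ?_, fun r hr => ?_⟩
    · filter_upwards [hco] with x hx hxB
      rw [hx]; exact hf0 x hxB
    · rw [eI]
      have e2 : ∫ x in (closedBall x₀ r)ᶜ, max ((hf.toLp f) x) 0 ∂μ =
          ∫ x in (closedBall x₀ r)ᶜ, max (f x) 0 ∂μ := by
        refine integral_congr_ae (ae_restrict_of_ae ?_)
        filter_upwards [hco] with x hx
        rw [hx]
      rw [e2]
      exact gen r hr _ hfI.pos_part fun x hx => max_le (abs_le.1 (hf1 x hx)).2 zero_le_one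
    · rw [eI]
      have e2 : ∫ x in (closedBall x₀ r)ᶜ, max (-((hf.toLp f) x)) 0 ∂μ =
          ∫ x in (closedBall x₀ r)ᶜ, max (-(f x)) 0 ∂μ := by
        refine integral_congr_ae (ae_restrict_of_ae ?_)
        filter_upwards [hco] with x hx
        rw [hx]
      rw [e2]
      exact gen r hr _ hfI.neg_part fun x hx =>
        max_le (by linarith [(abs_le.1 (hf1 x hx)).1]) zero_le_one

end concrete_part

theorem statement18 (μ ν : Measure X) [IsProbabilityMeasure μ] [IsProbabilityMeasure ν]
    (x₀ : X) (c : X → X → ℝ) (hcmeas : Measurable (Function.uncurry c))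
    (hcnn : ∀ x y, 0 ≤ c x y) (ε : ℝ) (hε : 0 < ε)
    (p δ : ℝ) (hp : 0 < p) (hδ : 0 < δ)
    (hcbdd : ∀ r : ℝ,
      BddAbove {v : ℝ | ∃ x ∈ closedBall x₀ r, ∃ y ∈ closedBall x₀ r, v = c x y})
    (hclim : Tendsto (fun r : ℝ =>
        sSup {v : ℝ | ∃ x ∈ closedBall x₀ r, ∃ y ∈ closedBall x₀ r, v = c x y} / r ^ p)
      atTop (𝓝 0))
    (htaillim : Tendsto (fun r : ℝ =>
        max (μ ((closedBall x₀ r)ᶜ)).toReal (ν ((closedBall x₀ r)ᶜ)).toReal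
          / Real.exp (-r ^ (p + δ))) atTop (𝓝 0)) :
    ∃ mlow : ℝ, 0 < mlow ∧ ∀ m : ℝ, mlow ≤ m →
      ∃ κ : ℝ, 0 < κ ∧ κ < 1 ∧
        ∀ g ∈ Gcone μ x₀ m m (fun r => Real.exp (-r ^ (p + δ / 2)))
            (fun r => Real.exp (-r ^ (p + δ / 2))),
          (∀ᵐ x ∂μ, 0 ≤ g x) → 0 < ∫ x, g x ∂μ →
        ∀ g' ∈ Gcone μ x₀ m m (fun r => Real.exp (-r ^ (p + δ / 2)))
            (fun r => Real.exp (-r ^ (p + δ / 2))),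
          (∀ᵐ x ∂μ, 0 ≤ g' x) → 0 < ∫ x, g' x ∂μ →
        ∃ (hm : MemLp (fun x => (∫ y, Real.exp (-c x y / ε) *
              (∫ z, Real.exp (-c z y / ε) * g z ∂μ)⁻¹ ∂ν)⁻¹) 2 μ)
          (hm' : MemLp (fun x => (∫ y, Real.exp (-c x y / ε) *
              (∫ z, Real.exp (-c z y / ε) * g' z ∂μ)⁻¹ ∂ν)⁻¹) 2 μ),
          hilbertD (Gcone μ x₀ m m (fun r => Real.exp (-r ^ (p + δ / 2)))
              (fun r => Real.exp (-r ^ (p + δ / 2)))) (hm.toLp _) (hm'.toLp _)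
            ≤ ENNReal.ofReal κ *
              hilbertD (Gcone μ x₀ m m (fun r => Real.exp (-r ^ (p + δ / 2)))
                (fun r => Real.exp (-r ^ (p + δ / 2)))) g g' := by
  set q := p + δ / 2 with hq
  have hδ2 : 0 < δ / 2 := by linarith
  have E1 := hclim.eventually (gt_mem_nhds hε)
  have E2 := htaillim.eventually (gt_mem_nhds (zero_lt_one' ℝ))
  have E3 := (tendsto_rpow_atTop hδ2).eventually_ge_atTop (4 * (2 : ℝ) ^ p + 21)
  have E4 := (tendsto_rpow_atTop hp).eventually_ge_atTop (max 1000 (2 / (1 - ((2 : ℝ) ^ p)⁻¹)))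
  obtain ⟨R, hR⟩ := eventually_atTop.1 (E1.and (E2.and (E3.and E4)))
  refine ⟨max R 1, lt_of_lt_of_le one_pos (le_max_right _ _), fun m hm => ?_⟩
  have hm1 : 1 ≤ m := (le_max_right _ _).trans hm
  have hRm : ∀ r, m ≤ r → R ≤ r := fun r hr => ((le_max_left _ _).trans hm).trans hr
  have hmp := Real.rpow_nonneg (by linarith : 0 ≤ m) p
  have hcomm : ∀ r, m ≤ r → 0 < r ^ p ∧ r ^ q = r ^ p * r ^ (δ / 2) ∧
      r ^ (p + δ) = r ^ q * r ^ (δ / 2) ∧ 4 * (2 : ℝ) ^ p + 21 ≤ r ^ (δ / 2) ∧ r ^ p ≤ r ^ q := by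
    intro r hr
    have hr0 : 0 < r := by linarith
    refine ⟨Real.rpow_pos_of_pos hr0 p, Real.rpow_add hr0 _ _, ?_, (hR r (hRm r hr)).2.2.1,
      Real.rpow_le_rpow_of_exponent_le (by linarith) (by linarith)⟩
    rw [← Real.rpow_add hr0]
    congr 1
    rw [hq]; ring
  have htl : ∀ r, m ≤ r → max (μ ((closedBall x₀ r)ᶜ)).toReal (ν ((closedBall x₀ r)ᶜ)).toReal ≤
      Real.exp (-(20 * m ^ p)) * Real.exp (-r ^ q) := by
    intro r hr
    have k := (hR r (hRm r hr)).2.1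
    rw [div_lt_one (Real.exp_pos _)] at k
    refine k.le.trans ?_
    rw [← Real.exp_add]
    refine Real.exp_le_exp.2 ?_
    obtain ⟨a1, a2, a3, a4, a5⟩ := hcomm r hr
    have a6 : m ^ p ≤ r ^ p := Real.rpow_le_rpow (by linarith) hr hp.le
    have a7 : (0 : ℝ) < 2 ^ p := by positivity
    have a8 : r ^ q * 21 ≤ r ^ q * r ^ (δ / 2) :=
      mul_le_mul_of_nonneg_left (by linarith) (by linarith)
    rw [a3]
    linarith
  have H := build_good μ ν x₀ c hcmeas hcnn ε hε p q m hp hm1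
    (fun r hr x hx y hy => by
      have k := (hR r (hRm r hr)).1
      rw [div_lt_iff₀ (hcomm r hr).1] at k
      exact (le_csSup (hcbdd r) ⟨x, hx, y, hy, rfl⟩).trans k.le)
    (fun r hr => (le_max_left _ _).trans (htl r hr))
    (fun r hr => (le_max_right _ _).trans (htl r hr))
    (fun r hr => by
      obtain ⟨a1, a2, a3, a4, a5⟩ := hcomm r hr
      rw [Real.mul_rpow (by norm_num) (by linarith), a2]
      have := mul_le_mul_of_nonneg_left a4 a1.le
      linarith)
    ((le_max_right _ _).trans (hR m (hRm m le_rfl)).2.2.2)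
    ((le_max_left _ _).trans (hR m (hRm m le_rfl)).2.2.2)
  have hE := H.E_ge
  have hfrac : 0 < 1 / (16 * Real.exp (m ^ p)) := by positivity
  have hfrac2 : 1 / (16 * Real.exp (m ^ p)) < 1 := by
    rw [div_lt_one (by positivity)]; linarith
  refine ⟨1 - 1 / (16 * Real.exp (m ^ p)), by linarith, by linarith, ?_⟩
  intro g hg hn hi g' hg' hn' hi'
  exact main_abs H g g' hg hn hi hg' hn' hi'

end Paper
end
end
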